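/- Let q be an even prime power with q ≥ 2048, and let K be a complete k-cap in PG(4, q) with k ≥ q³ − 2q² + 3q√q + 8q − 9√q − 6. Then for every point N of PG(4, q) not in K, all tangent lines of K passing through N are contained in a common hyperplane of PG(4, q). -/

import Mathlib

open Module

/-- Points of the projective space `PG(n, q)` over the field `F` (with `q = |F|`). -/
abbrev PGPoint (F : Type*) [Field F] (n : ℕ) := Projectivization F (Fin (n + 1) → F)

/-- The set of projective points lying in the projective subspace determined by
a linear subspace `W`. -/
def ptsIn {F : Type*} [Field F] {n : ℕ} (W : Submodule F (Fin (n + 1) → F)) :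
    Set (PGPoint F n) := {P | P.submodule ≤ W}

/-- Three points of `PG(n, q)` are collinear if they lie on a common line. -/
def Coll3 {F : Type*} [Field F] {n : ℕ} (P₁ P₂ P₃ : PGPoint F n) : Prop :=
  Module.finrank F ↥(P₁.submodule ⊔ P₂.submodule ⊔ P₃.submodule) ≤ 2

/-- A cap (a plane arc when `n = 2`): a set of points no three of which are collinear. -/
def IsCap {F : Type*} [Field F] {n : ℕ} (K : Set (PGPoint F n)) : Prop :=
  ∀ P₁ ∈ K, ∀ P₂ ∈ K, ∀ P₃ ∈ K, P₁ ≠ P₂ → P₁ ≠ P₃ → P₂ ≠ P₃ → ¬ Coll3 P₁ P₂ P₃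

/-- A complete cap: a cap that is not contained in a cap with one more point. -/
def IsCompleteCap {F : Type*} [Field F] {n : ℕ} (K : Set (PGPoint F n)) : Prop :=
  IsCap K ∧ ∀ P ∉ K, ¬ IsCap (insert P K)

/-- A tangent line of `K`: a line (2-dimensional linear subspace) meeting `K`
in exactly one point. -/
def IsTangent {F : Type*} [Field F] {n : ℕ} (K : Set (PGPoint F n))
    (W : Submodule F (Fin (n + 1) → F)) : Prop :=
  Module.finrank F W = 2 ∧ (ptsIn W ∩ K).ncard = 1

namespace CapAux
/-! ### Part 1: plane arcs in even characteristic -/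

section alg
variable {F : Type*} [Field F]

/-- The 3 by 3 determinant. -/
def D3 (a b c : Fin 3 → F) : F :=
  a 0 * (b 1 * c 2 - b 2 * c 1) - a 1 * (b 0 * c 2 - b 2 * c 0) + a 2 * (b 0 * c 1 - b 1 * c 0)

lemma D3_plucker (a y z u w : Fin 3 → F) :
    D3 a y z * D3 a u w = D3 a y u * D3 a z w - D3 a y w * D3 a z u := by
  unfold D3; ring

lemma D3_self (a y : Fin 3 → F) : D3 a y y = 0 := by unfold D3; ring
lemma D3_self' (a y : Fin 3 → F) : D3 a a y = 0 := by unfold D3; ring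
lemma D3_self'' (a y : Fin 3 → F) : D3 a y a = 0 := by unfold D3; ring

lemma D3_swap23 (h2 : (2 : F) = 0) (a b c : Fin 3 → F) : D3 a b c = D3 a c b := by
  unfold D3
  linear_combination (a 0 * (b 1 * c 2 - b 2 * c 1) - a 1 * (b 0 * c 2 - b 2 * c 0)
    + a 2 * (b 0 * c 1 - b 1 * c 0)) * h2

lemma D3_swap12 (h2 : (2 : F) = 0) (a b c : Fin 3 → F) : D3 a b c = D3 b a c := by
  unfold D3
  linear_combination (a 0 * (b 1 * c 2 - b 2 * c 1) - a 1 * (b 0 * c 2 - b 2 * c 0)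
    + a 2 * (b 0 * c 1 - b 1 * c 0)) * h2

lemma D3_add_smul (a b u w : Fin 3 → F) (μ : F) :
    D3 a b (u + μ • w) = D3 a b u + μ * D3 a b w := by
  simp only [D3, Pi.add_apply, Pi.smul_apply, smul_eq_mul]; ring

lemma lagrange_aux {ι : Type*} [DecidableEq ι] (a : Fin 3 → F) (y : ι → Fin 3 → F)
    (M : List (Fin 3 → F)) : ∀ (Y : Finset ι), Y.card = M.length + 2 →
    (∀ i ∈ Y, ∀ j ∈ Y, i ≠ j → D3 a (y i) (y j) ≠ 0) →
    ∑ i ∈ Y, (M.map (fun z => D3 a (y i) z)).prod * ∏ j ∈ Y.erase i, (D3 a (y i) (y j))⁻¹ = 0 := by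
  induction M with
  | nil =>
    intro Y hY hne
    obtain ⟨i, j, hij, rfl⟩ := Finset.card_eq_two.mp hY
    have e1 : ({i, j} : Finset ι).erase i = {j} := by
      ext x; simp only [Finset.mem_erase, Finset.mem_insert, Finset.mem_singleton]
      constructor
      · rintro ⟨h, h' | h'⟩ <;> simp_all
      · rintro rfl; exact ⟨hij.symm, Or.inr rfl⟩
    have e2 : ({i, j} : Finset ι).erase j = {i} := by
      ext x; simp only [Finset.mem_erase, Finset.mem_insert, Finset.mem_singleton]
      constructor
      · rintro ⟨h, h' | h'⟩ <;> simp_all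
      · rintro rfl; exact ⟨hij, Or.inl rfl⟩
    rw [Finset.sum_pair hij, e1, e2]
    simp only [List.map_nil, List.prod_nil, Finset.prod_singleton, one_mul]
    have h3 : D3 a (y j) (y i) = - D3 a (y i) (y j) := by unfold D3; ring
    rw [h3, inv_neg]; ring
  | cons z M ih =>
    intro Y hY hne
    have hc : 1 < Y.card := by rw [hY]; simp
    obtain ⟨i0, hi0, i1, hi1, h01⟩ := Finset.one_lt_card.mp hc
    have key : ∀ r ∈ Y, ∑ i ∈ Y, D3 a (y i) (y r) * ((M.map (fun z => D3 a (y i) z)).prod *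
        ∏ j ∈ Y.erase i, (D3 a (y i) (y j))⁻¹) = 0 := by
      intro r hr
      have hcard : (Y.erase r).card = M.length + 2 := by
        rw [Finset.card_erase_of_mem hr, hY]; simp
      have := ih (Y.erase r) hcard (fun i hi j hj hij =>
        hne i (Finset.mem_of_mem_erase hi) j (Finset.mem_of_mem_erase hj) hij)
      rw [← Finset.add_sum_erase _ _ hr, D3_self, zero_mul, zero_add]
      rw [← this]
      apply Finset.sum_congr rfl
      intro i hi
      have hir : i ≠ r := Finset.ne_of_mem_erase hi
      have hr' : r ∈ Y.erase i := Finset.mem_erase.mpr ⟨hir.symm, hr⟩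
      rw [← Finset.mul_prod_erase _ _ hr', Finset.erase_right_comm]
      have hnz := hne i (Finset.mem_of_mem_erase hi) r hr hir
      field_simp
    have h0 := key i0 hi0
    have h1 := key i1 hi1
    have hnz := hne i0 hi0 i1 hi1 h01
    have : (∑ i ∈ Y, ((z :: M).map (fun z => D3 a (y i) z)).prod *
        ∏ j ∈ Y.erase i, (D3 a (y i) (y j))⁻¹) * D3 a (y i0) (y i1) = 0 := by
      have e : (∑ i ∈ Y, ((z :: M).map (fun z => D3 a (y i) z)).prod *
        ∏ j ∈ Y.erase i, (D3 a (y i) (y j))⁻¹) * D3 a (y i0) (y i1)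
        = D3 a z (y i1) * (∑ i ∈ Y, D3 a (y i) (y i0) * ((M.map (fun z => D3 a (y i) z)).prod *
        ∏ j ∈ Y.erase i, (D3 a (y i) (y j))⁻¹)) - D3 a z (y i0) *
        (∑ i ∈ Y, D3 a (y i) (y i1) * ((M.map (fun z => D3 a (y i) z)).prod *
        ∏ j ∈ Y.erase i, (D3 a (y i) (y j))⁻¹)) := by
        rw [Finset.sum_mul, Finset.mul_sum, Finset.mul_sum, ← Finset.sum_sub_distrib]
        apply Finset.sum_congr rfl
        intro i _
        have := D3_plucker a (y i) z (y i0) (y i1)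
        simp only [List.map_cons, List.prod_cons]
        linear_combination ((M.map (fun z => D3 a (y i) z)).prod *
          ∏ j ∈ Y.erase i, (D3 a (y i) (y j))⁻¹) * this
      rw [e, h0, h1]; ring
    exact (mul_eq_zero.mp this).resolve_right hnz

lemma prod_ne_zero_eq_one [Fintype F] [DecidableEq F] (h2 : (2 : F) = 0) :
    ∏ x ∈ Finset.univ.erase (0 : F), x = 1 := by
  have h := FiniteField.prod_univ_units_id_eq_neg_one (K := F)
  have h' : ∏ x : Fˣ, (x : F) = 1 := by
    have := congrArg (Units.val) h
    rw [Units.coe_prod] at this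
    rw [this]; push_cast; linear_combination -h2
  rw [← h']
  symm
  apply Finset.prod_bij (fun (x : Fˣ) _ => (x : F))
  · intro x _; simp
  · intro x _ y _ h; exact Units.ext h
  · intro b hb; exact ⟨Units.mk0 b (Finset.ne_of_mem_erase hb), Finset.mem_univ _, rfl⟩
  · intro x _; rfl

/-- The tangent forms at a point of an arc. -/
lemma tangent_forms [Fintype F] {ι : Type*} [Fintype ι] [DecidableEq ι]
    (h2 : (2 : F) = 0) (p : ι → Fin 3 → F)
    (hp : ∀ i j k, i ≠ j → i ≠ k → j ≠ k → D3 (p i) (p j) (p k) ≠ 0)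
    (h3 : 3 ≤ Fintype.card ι) (a : ι) :
    ∃ (M : List (Fin 3 → F)) (C : F), M.length + Fintype.card ι = Fintype.card F + 2 ∧ C ≠ 0 ∧
      (∀ b, b ≠ a → (M.map (fun z => D3 (p a) (p b) z)).prod *
        ∏ s ∈ (Finset.univ.erase a).erase b, D3 (p a) (p b) (p s) = C) ∧
      (∀ x, (∀ s, s ≠ a → D3 (p a) x (p s) ≠ 0) →
        (M.map (fun z => D3 (p a) x z)).prod = 0) := by
  classical
  have hc : 1 < (Finset.univ.erase a).card := by
    rw [Finset.card_erase_of_mem (Finset.mem_univ _), Finset.card_univ]; omega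
  obtain ⟨w, hw, u, hu, hwu⟩ := Finset.one_lt_card.mp hc
  have hwa := Finset.ne_of_mem_erase hw
  have hua := Finset.ne_of_mem_erase hu
  set B : (Fin 3 → F) → (Fin 3 → F) → F := D3 (p a) with hB
  have huw : B (p u) (p w) ≠ 0 := hp a u w hua.symm hwa.symm hwu.symm
  set R := (Finset.univ.erase a).erase w with hR
  have hRm : ∀ s, s ∈ R ↔ s ≠ w ∧ s ≠ a := by intro s; simp [hR]
  set μ : ι → F := fun s => B (p s) (p u) / B (p s) (p w) with hμ
  have hsw : ∀ s ∈ R, B (p s) (p w) ≠ 0 := fun s hs =>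
    hp a s w ((hRm s).1 hs).2.symm hwa.symm ((hRm s).1 hs).1
  have hform : ∀ s ∈ R, ∀ y, B y (p u + μ s • p w) = B y (p s) * (B (p u) (p w) / B (p s) (p w)) := by
    intro s hs y
    have h := hsw s hs
    rw [hB, D3_add_smul, ← hB, hμ]
    simp only
    have hpl : B y (p s) * B (p u) (p w) = B y (p u) * B (p s) (p w) - B y (p w) * B (p s) (p u) :=
      D3_plucker _ _ _ _ _
    field_simp
    linear_combination (B y (p w) * B (p s) (p u)) * h2 - hpl
  have hinj : Set.InjOn μ R := by
    intro s hs s' hs' h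
    by_contra hne
    have h1 := hform s hs (p s)
    have h2' := hform s' hs' (p s)
    rw [h, h2'] at h1
    have : B (p s) (p s) = 0 := D3_self _ _
    rw [this, zero_mul] at h1
    rcases mul_eq_zero.mp h1 with h1 | h1
    · exact hp a s s' ((hRm s).1 hs).2.symm ((hRm s').1 hs').2.symm hne h1
    · exact (div_ne_zero huw (hsw s' hs')) h1
  set T := Finset.univ \ R.image μ with hT
  have hRcard : R.card + 2 = Fintype.card ι := by
    rw [hR, Finset.card_erase_of_mem (by simp [hwa]), Finset.card_erase_of_mem (Finset.mem_univ _),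
      Finset.card_univ]; omega
  have hTcard : T.card + R.card = Fintype.card F := by
    rw [hT, ← Finset.card_image_of_injOn hinj, Finset.card_sdiff_add_card_eq_card (Finset.subset_univ _),
      Finset.card_univ]
  have hmapprod : ∀ y, ((T.toList.map (fun m => p u + m • p w)).map (fun z => B y z)).prod =
      ∏ m ∈ T, B y (p u + m • p w) := by
    intro y
    rw [List.map_map, Finset.prod_map_toList]; rfl
  refine ⟨T.toList.map (fun m => p u + m • p w),
    (∏ s ∈ R, (B (p s) (p w) / B (p u) (p w))) * B (p u) (p w), ?_, ?_, ?_, ?_⟩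
  · simp only [List.length_map, Finset.length_toList]; omega
  · exact mul_ne_zero (Finset.prod_ne_zero_iff.mpr fun s hs => div_ne_zero (hsw s hs) huw) huw
  · intro b hba
    rw [hmapprod]
    by_cases hbw : b = w
    · subst hbw
      have e1 : ∀ m ∈ T, B (p b) (p u + m • p b) = B (p u) (p b) := by
        intro m _
        rw [hB, D3_add_smul, D3_self, mul_zero, add_zero, D3_swap23 h2]
      have e2 : ∏ s ∈ R, B (p b) (p s) = ∏ s ∈ R, B (p s) (p b) :=
        Finset.prod_congr rfl fun s _ => D3_swap23 h2 _ _ _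
      rw [Finset.prod_congr rfl e1, Finset.prod_const, ← hR, e2, Finset.prod_div_distrib,
        Finset.prod_const]
      have hq : B (p u) (p b) ^ (T.card + R.card) = B (p u) (p b) := by
        rw [hTcard]; exact FiniteField.pow_card _
      rw [pow_add] at hq
      field_simp
      linear_combination (∏ s ∈ R, B (p s) (p b)) * hq
    · have hbR : b ∈ R := (hRm b).2 ⟨hbw, hba⟩
      have hbw0 := hsw b hbR
      have e0 : ∀ m, B (p b) (p u + m • p w) = B (p b) (p w) * (m - μ b) := by
        intro m
        rw [hB, D3_add_smul, ← hB, hμ]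
        simp only
        field_simp
        linear_combination (B (p b) (p u)) * h2
      have e1 : ∏ m ∈ Finset.univ.erase (μ b), B (p b) (p u + m • p w) = 1 := by
        rw [Finset.prod_congr rfl fun m _ => e0 m, Finset.prod_mul_distrib, Finset.prod_const,
          Finset.card_erase_of_mem (Finset.mem_univ _), Finset.card_univ,
          FiniteField.pow_card_sub_one_eq_one _ hbw0, one_mul, ← prod_ne_zero_eq_one h2]
        apply Finset.prod_bij (fun m _ => m - μ b)
        · intro m hm; simp only [Finset.mem_erase, Finset.mem_univ, and_true] at hm ⊢
          exact sub_ne_zero.mpr hm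
        · intro m _ m' _ h; exact sub_left_injective h
        · intro m hm
          refine ⟨m + μ b, ?_, by ring⟩
          simp only [Finset.mem_erase, Finset.mem_univ, and_true] at hm ⊢
          intro h; apply hm; linear_combination h
        · intro m _; rfl
      have e2 : Finset.univ.erase (μ b) = T ∪ (R.erase b).image μ := by
        ext m
        simp only [hT, Finset.mem_erase, Finset.mem_univ, and_true, Finset.mem_union,
          Finset.mem_sdiff, true_and, Finset.mem_image]
        constructor
        · intro h
          by_cases hm : ∃ s ∈ R, μ s = m
          · obtain ⟨s, hs, rfl⟩ := hm
            right; exact ⟨s, ⟨fun h' => h (by rw [h']), hs⟩, rfl⟩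
          · left; exact hm
        · rintro (h | ⟨s, ⟨hsb, hs⟩, rfl⟩)
          · intro h'; exact h ⟨b, hbR, h'.symm⟩
          · intro h'; exact hsb (hinj hs hbR h')
      have e3 : Disjoint T ((R.erase b).image μ) := by
        rw [Finset.disjoint_left]
        intro m hm hm'
        simp only [hT, Finset.mem_sdiff, Finset.mem_univ, true_and] at hm
        exact hm (Finset.image_subset_image (Finset.erase_subset _ _) hm')
      rw [e2, Finset.prod_union e3, Finset.prod_image (hinj.mono (by
        intro s hs; exact Finset.mem_of_mem_erase hs))] at e1
      rw [Finset.prod_congr rfl (fun s hs => hform s (Finset.mem_of_mem_erase hs) (p b)),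
        Finset.prod_mul_distrib] at e1
      have hw' : w ∈ (Finset.univ.erase a).erase b := by simp [hwa, Ne.symm hbw]
      have e5 : ((Finset.univ.erase a).erase b).erase w = R.erase b := by
        rw [hR, Finset.erase_right_comm]
      rw [← Finset.mul_prod_erase _ _ hw', e5, ← Finset.mul_prod_erase _ _ hbR]
      have e6 : (∏ s ∈ R.erase b, B (p s) (p w) / B (p u) (p w)) *
          (∏ s ∈ R.erase b, B (p u) (p w) / B (p s) (p w)) = 1 := by
        rw [← Finset.prod_mul_distrib]
        apply Finset.prod_eq_one
        intro s hs
        have := hsw s (Finset.mem_of_mem_erase hs)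
        field_simp
      have e7 : B (p b) (p w) / B (p u) (p w) * B (p u) (p w) = B (p b) (p w) := by field_simp
      linear_combination (B (p b) (p w) * ∏ s ∈ R.erase b, B (p s) (p w) / B (p u) (p w)) * e1
        - (∏ m ∈ T, B (p b) (p u + m • p w)) * B (p b) (p w) *
          (∏ s ∈ R.erase b, B (p b) (p s)) * e6
        - (∏ s ∈ R.erase b, B (p s) (p w) / B (p u) (p w)) * e7
  · intro x hx
    rw [hmapprod]
    have hxw := hx w hwa
    apply Finset.prod_eq_zero (i := B x (p u) / B x (p w))
    · simp only [hT, Finset.mem_sdiff, Finset.mem_univ, true_and, Finset.mem_image, not_exists, not_and]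
      intro s hs h
      have h1 := hform s hs x
      rw [h, hB, D3_add_smul, ← hB] at h1
      have h4 : B x (p u) + B x (p u) / B x (p w) * B x (p w) = 0 := by
        field_simp; linear_combination (B x (p u)) * h2
      rw [h4] at h1
      rcases mul_eq_zero.mp h1.symm with h1 | h1
      · exact hx s ((hRm s).1 hs).2 h1
      · exact (div_ne_zero huw (hsw s hs)) h1
    · rw [hB, D3_add_smul, ← hB]
      field_simp; linear_combination (B x (p u)) * h2

lemma sum_symm_zero (h2 : (2 : F) = 0) {ι : Type*} [DecidableEq ι] (E : Finset ι) (g : ι → ι → F)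
    (hg : ∀ a b, a ≠ b → g a b = g b a) : ∑ a ∈ E, ∑ b ∈ E.erase a, g a b = 0 := by
  rw [Finset.sum_sigma']
  apply Finset.sum_involution (fun x _ => ⟨x.2, x.1⟩)
  · rintro ⟨a, b⟩ hx
    simp only [Finset.mem_sigma, Finset.mem_erase] at hx
    simp only
    rw [hg a b (Ne.symm hx.2.1)]
    linear_combination (g b a) * h2
  · rintro ⟨a, b⟩ hx _ h
    simp only [Finset.mem_sigma, Finset.mem_erase] at hx
    apply hx.2.1
    simp only [Sigma.mk.injEq] at h
    exact h.1
  · rintro ⟨a, b⟩ hx; rfl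
  · rintro ⟨a, b⟩ hx
    simp only [Finset.mem_sigma, Finset.mem_erase] at hx ⊢
    exact ⟨hx.2.2, Ne.symm hx.2.1, hx.1⟩

lemma arc_tangents [Fintype F] {ι : Type*} [Fintype ι] [DecidableEq ι]
    (h2 : (2 : F) = 0) (p : ι → Fin 3 → F)
    (hp : ∀ i j k, i ≠ j → i ≠ k → j ≠ k → D3 (p i) (p j) (p k) ≠ 0)
    (h3 : 3 ≤ Fintype.card ι) (x : Fin 3 → F) (Q R : ι) (hQR : Q ≠ R) (σ ρ : F)
    (hx : x = σ • p Q + ρ • p R) (hρ : ρ ≠ 0) (T : Finset ι)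
    (hT : ∀ i ∈ T, ∀ s, s ≠ i → D3 (p i) x (p s) ≠ 0) :
    T.card + Fintype.card ι ≤ Fintype.card F + 2 := by
  classical
  by_contra hcon
  push Not at hcon
  choose M C hM hC hMC hM0 using tangent_forms h2 p hp h3
  set d := (M Q).length with hd
  have hlen : ∀ a, (M a).length = d := by
    intro a; have := hM a; have := hM Q; omega
  have hTd : d + 1 ≤ T.card := by have := hM Q; omega
  obtain ⟨T', hT'T, hT'c⟩ := Finset.exists_subset_card_eq hTd
  have hQx : ∀ z, D3 (p Q) x z = ρ * D3 (p Q) (p R) z := by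
    intro z; rw [hx]; simp only [D3, Pi.add_apply, Pi.smul_apply, smul_eq_mul]; ring
  have hQT : Q ∉ T' := by
    intro h
    apply hT Q (hT'T h) R hQR.symm
    rw [hQx, D3_self, mul_zero]
  set E := insert Q T' with hE
  have hEc : E.card = d + 2 := by rw [hE, Finset.card_insert_of_notMem hQT, hT'c]
  have hEx : ∀ a ∈ E, ∀ b ∈ E, a ≠ b → D3 (p a) x (p b) ≠ 0 := by
    intro a ha b hb hab
    rcases Finset.mem_insert.mp ha with rfl | ha
    · rcases Finset.mem_insert.mp hb with rfl | hb
      · exact absurd rfl hab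
      · have := hT b (hT'T hb) a hab
        rwa [D3_swap23 h2, D3_swap12 h2, D3_swap23 h2]
    · exact hT a (hT'T ha) b hab.symm
  have hlag : ∀ a ∈ E, ((M a).map (fun z => D3 (p a) x z)).prod * ∏ b ∈ E.erase a, (D3 (p a) x (p b))⁻¹
      + ∑ b ∈ E.erase a, ((M a).map (fun z => D3 (p a) (p b) z)).prod *
        ((D3 (p a) (p b) x)⁻¹ * ∏ s ∈ (E.erase a).erase b, (D3 (p a) (p b) (p s))⁻¹) = 0 := by
    intro a ha
    have key := lagrange_aux (p a) (fun o : Option ι => o.elim x p) (M a) (Finset.insertNone (E.erase a))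
      (by rw [Finset.card_insertNone, Finset.card_erase_of_mem ha, hEc, hlen]; rfl) (by
        intro i hi j hj hij
        rcases i with _ | i <;> rcases j with _ | j
        · exact absurd rfl hij
        · have hj' := Finset.some_mem_insertNone.mp hj
          exact hEx a ha j (Finset.mem_of_mem_erase hj') (Finset.ne_of_mem_erase hj').symm
        · have hj' := Finset.some_mem_insertNone.mp hi
          have := hEx a ha i (Finset.mem_of_mem_erase hj') (Finset.ne_of_mem_erase hj').symm
          rwa [D3_swap23 h2] at this
        · have hi' := Finset.some_mem_insertNone.mp hi
          have hj' := Finset.some_mem_insertNone.mp hj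
          exact hp a i j (Finset.ne_of_mem_erase hi').symm (Finset.ne_of_mem_erase hj').symm
            (fun h => hij (by rw [h])))
    have hins : Finset.insertNone (E.erase a) = insert none ((E.erase a).map Function.Embedding.some) := by
      ext o; rcases o with _ | o <;> simp
    have hnn : (none : Option ι) ∉ (E.erase a).map Function.Embedding.some := by simp
    rw [hins, Finset.sum_insert hnn, Finset.erase_insert hnn, Finset.prod_map, Finset.sum_map] at key
    rw [← key]
    congr 1
    apply Finset.sum_congr rfl
    intro b hb
    have e1 : (insert none ((E.erase a).map Function.Embedding.some)).erase (Function.Embedding.some b)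
      = insert none (((E.erase a).erase b).map Function.Embedding.some) := by
      ext o; rcases o with _ | o <;> simp
    rw [e1, Finset.prod_insert (by simp), Finset.prod_map]
    rfl
  have hdiv : ∀ a ∈ E, (C a)⁻¹ * ((M a).map (fun z => D3 (p a) x z)).prod * ∏ b ∈ E.erase a, (D3 (p a) x (p b))⁻¹
      + ∑ b ∈ E.erase a, (∏ s ∈ (Finset.univ.erase a).erase b, D3 (p a) (p b) (p s))⁻¹ *
        ((D3 (p a) (p b) x)⁻¹ * ∏ s ∈ (E.erase a).erase b, (D3 (p a) (p b) (p s))⁻¹) = 0 := by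
    intro a ha
    have h := congrArg (fun t => (C a)⁻¹ * t) (hlag a ha)
    simp only [mul_add, mul_zero, Finset.mul_sum] at h
    rw [← h]
    congr 1
    · ring
    · apply Finset.sum_congr rfl
      intro b hb
      rw [← mul_assoc (C a)⁻¹]
      congr 1
      have h1 := hMC a b (Finset.ne_of_mem_erase hb)
      have h4 : ∏ s ∈ (Finset.univ.erase a).erase b, D3 (p a) (p b) (p s) ≠ 0 := by
        intro h0; rw [h0, mul_zero] at h1; exact hC a h1.symm
      have := hC a
      field_simp
      linear_combination -h1
  have hsum := Finset.sum_eq_zero hdiv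
  rw [Finset.sum_add_distrib, sum_symm_zero h2 E (fun a b => (∏ s ∈ (Finset.univ.erase a).erase b, D3 (p a) (p b) (p s))⁻¹ *
        ((D3 (p a) (p b) x)⁻¹ * ∏ s ∈ (E.erase a).erase b, (D3 (p a) (p b) (p s))⁻¹)), add_zero,
        Finset.sum_insert hQT] at hsum
  · rw [Finset.sum_eq_zero (s := T'), add_zero] at hsum
    · rcases mul_eq_zero.mp hsum with h | h
      · rcases mul_eq_zero.mp h with h | h
        · exact hC Q (inv_eq_zero.mp h)
        · simp only [hQx] at h
          have h5 : ∀ l : List (Fin 3 → F), (l.map (fun z => ρ * D3 (p Q) (p R) z)).prod =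
              ρ ^ l.length * (l.map (fun z => D3 (p Q) (p R) z)).prod := by
            intro l; induction l with
            | nil => simp
            | cons z l ih => simp only [List.map_cons, List.prod_cons, ih, List.length_cons]; ring
          rw [h5] at h
          have h6 := hMC Q R hQR.symm
          rcases mul_eq_zero.mp h with h | h
          · exact pow_ne_zero _ hρ h
          · rw [h, zero_mul] at h6; exact hC Q h6.symm
      · obtain ⟨b, hb, hb0⟩ := Finset.prod_eq_zero_iff.mp h
        exact hEx Q (Finset.mem_insert_self _ _) b (Finset.mem_of_mem_erase hb)
          (Finset.ne_of_mem_erase hb).symm (inv_eq_zero.mp hb0)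
    · intro a ha
      rw [hM0 a x (fun s hs => hT a (hT'T ha) s hs), mul_zero, zero_mul]
  · intro a b hab
    have e1 : ∀ z, D3 (p a) (p b) z = D3 (p b) (p a) z := fun z => D3_swap12 h2 _ _ _
    simp only [e1]
    rw [Finset.erase_right_comm, Finset.erase_right_comm (s := E)]

end alg
end CapAux

namespace CapAux

/-! ### Part 2: counting in projective spaces -/

section geo
set_option linter.unusedSectionVars false
open Classical Finset
open scoped LinearAlgebra.Projectivization

variable {F : Type*} [Field F] [Fintype F] {V : Type*} [AddCommGroup V] [Module F V]
  [FiniteDimensional F V] [Fintype (ℙ F V)] [Fintype (Submodule F V)]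

/-- The points of `A` in `W`. -/
noncomputable def inc (A : Finset (ℙ F V)) (W : Submodule F V) : Finset (ℙ F V) :=
  A.filter (fun P => P.submodule ≤ W)

/-- The number of points of `A` in `W`. -/
noncomputable def pts (A : Finset (ℙ F V)) (W : Submodule F V) : ℕ := (inc A W).card

/-- The subspaces between `U` and `X` of dimension one more than `U`. -/
noncomputable def cov (U X : Submodule F V) : Finset (Submodule F V) :=
  univ.filter (fun W => U ≤ W ∧ W ≤ X ∧ finrank F W = finrank F U + 1)

lemma mem_inc {A : Finset (ℙ F V)} {W : Submodule F V} {P : ℙ F V} :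
    P ∈ inc A W ↔ P ∈ A ∧ P.submodule ≤ W := by simp [inc]

lemma mem_cov {U X W : Submodule F V} :
    W ∈ cov U X ↔ U ≤ W ∧ W ≤ X ∧ finrank F W = finrank F U + 1 := by simp [cov]

lemma pt_inf {U : Submodule F V} {P : ℙ F V} (h : ¬ P.submodule ≤ U) : U ⊓ P.submodule = ⊥ := by
  have h1 := P.finrank_submodule
  have h2 : finrank F ↥(U ⊓ P.submodule) ≤ 1 := h1 ▸ Submodule.finrank_mono inf_le_right
  rcases Nat.lt_or_ge (finrank F ↥(U ⊓ P.submodule)) 1 with h3 | h3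
  · exact Submodule.finrank_eq_zero.mp (by omega)
  · exfalso
    have := Submodule.eq_of_le_of_finrank_eq (inf_le_right : U ⊓ P.submodule ≤ P.submodule) (by omega)
    exact h (by rw [← this]; exact inf_le_left)

lemma finrank_sup_pt {U : Submodule F V} {P : ℙ F V} (h : ¬ P.submodule ≤ U) :
    finrank F ↥(U ⊔ P.submodule) = finrank F U + 1 := by
  have := Submodule.finrank_sup_add_finrank_inf_eq U P.submodule
  rw [pt_inf h, P.finrank_submodule, finrank_bot] at this
  omega

lemma pt_le_pt {P Q : ℙ F V} (h : P.submodule ≤ Q.submodule) : P = Q :=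
  Projectivization.submodule_injective
    (Submodule.eq_of_le_of_finrank_eq h (by rw [P.finrank_submodule, Q.finrank_submodule]))

lemma finrank_line {P Q : ℙ F V} (h : P ≠ Q) : finrank F ↥(P.submodule ⊔ Q.submodule) = 2 := by
  rw [finrank_sup_pt (fun h' => h (pt_le_pt h').symm), P.finrank_submodule]

lemma sup_eq_cov {U X W : Submodule F V} (hW : W ∈ cov U X) {P : ℙ F V} (hP : P.submodule ≤ W)
    (hU : ¬ P.submodule ≤ U) : U ⊔ P.submodule = W := by
  obtain ⟨h1, h2, h3⟩ := mem_cov.mp hW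
  exact Submodule.eq_of_le_of_finrank_eq (sup_le h1 hP) (by rw [finrank_sup_pt hU, h3])

lemma sup_mem_cov {U X : Submodule F V} (hUX : U ≤ X) {P : ℙ F V} (hP : P.submodule ≤ X)
    (hU : ¬ P.submodule ≤ U) : U ⊔ P.submodule ∈ cov U X :=
  mem_cov.mpr ⟨le_sup_left, sup_le hUX hP, finrank_sup_pt hU⟩

lemma inc_mono {A : Finset (ℙ F V)} {U W : Submodule F V} (h : U ≤ W) : inc A U ⊆ inc A W := by
  intro P hP; rw [mem_inc] at *; exact ⟨hP.1, hP.2.trans h⟩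

lemma sum_cov (A : Finset (ℙ F V)) {U X : Submodule F V} (hUX : U ≤ X) :
    ∑ W ∈ cov U X, ((pts A W : ℤ) - pts A U) = pts A X - pts A U := by
  have h1 : ∀ W, U ≤ W → (pts A W : ℤ) - pts A U = ((inc A W \ inc A U).card : ℤ) := by
    intro W hW
    rw [card_sdiff_of_subset (inc_mono hW), Nat.cast_sub (card_le_card (inc_mono hW))]; rfl
  rw [h1 X hUX, sum_congr rfl (fun W hW => h1 W (mem_cov.mp hW).1)]
  rw [card_eq_sum_card_fiberwise (f := fun P : ℙ F V => U ⊔ P.submodule) (t := cov U X)]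
  · push_cast
    apply sum_congr rfl
    intro W hW
    congr 2
    ext P
    simp only [mem_sdiff, mem_inc, mem_filter]
    constructor
    · rintro ⟨⟨h2, h3⟩, h4⟩
      have h5 : ¬ P.submodule ≤ U := fun h => h4 ⟨h2, h⟩
      exact ⟨⟨⟨h2, h3.trans (mem_cov.mp hW).2.1⟩, h4⟩, sup_eq_cov hW h3 h5⟩
    · rintro ⟨⟨⟨h2, h3⟩, h4⟩, h5⟩
      exact ⟨⟨h2, h5 ▸ le_sup_right⟩, h4⟩
  · intro P hP
    simp only [coe_sdiff, Set.mem_sdiff, mem_coe, mem_inc] at hP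
    exact sup_mem_cov hUX hP.1.2 (fun h => hP.2 ⟨hP.1.1, h⟩)

lemma pts_univ (W : Submodule F V) :
    pts (univ : Finset (ℙ F V)) W = ∑ i ∈ range (finrank F W), Fintype.card F ^ i := by
  have h := Projectivization.card_of_finrank F W rfl
  rw [Nat.card_eq_fintype_card (α := F)] at h
  rw [← h]
  have : Finite V := Module.finite_of_finite F
  have : Fintype (ℙ F W) := Fintype.ofFinite _
  rw [Nat.card_eq_fintype_card, ← card_univ]
  symm
  unfold pts
  apply card_bij (fun (P : ℙ F W) _ => Projectivization.map W.subtype W.subtype_injective P)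
  · intro P _
    rw [mem_inc]
    refine ⟨mem_univ _, ?_⟩
    induction P using Projectivization.ind with
    | h v hv =>
      rw [Projectivization.map_mk, Projectivization.submodule_mk, Submodule.span_singleton_le_iff_mem]
      exact v.2
  · intro P _ Q _ h
    exact Projectivization.map_injective (τ := RingHom.id F) W.subtype W.subtype_injective h
  · intro P hP
    have hP' := (mem_inc.mp hP).2
    induction P using Projectivization.ind with
    | h v hv =>
      rw [Projectivization.submodule_mk, Submodule.span_singleton_le_iff_mem] at hP'
      refine ⟨Projectivization.mk F ⟨v, hP'⟩ (by simpa using hv), mem_univ _, ?_⟩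
      rw [Projectivization.map_mk]; rfl

lemma card_cov {U X : Submodule F V} (hUX : U ≤ X) :
    (cov U X).card = ∑ i ∈ range (finrank F X - finrank F U), Fintype.card F ^ i := by
  have h := sum_cov (univ : Finset (ℙ F V)) hUX
  have hle := Submodule.finrank_mono hUX
  obtain ⟨n, hn⟩ := Nat.exists_eq_add_of_le hle
  rw [sum_congr rfl (g := fun _ => (Fintype.card F : ℤ) ^ finrank F U)] at h
  · rw [sum_const, pts_univ, pts_univ, hn, sum_range_add] at h
    rw [hn, Nat.add_sub_cancel_left]
    push_cast at h
    simp only [pow_add, ← mul_sum, nsmul_eq_mul, add_sub_cancel_left] at h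
    have hq : ((Fintype.card F : ℤ) ^ finrank F U) ≠ 0 := pow_ne_zero _ (by exact_mod_cast Fintype.card_ne_zero)
    rw [mul_comm] at h
    have := mul_left_cancel₀ hq h
    exact_mod_cast this
  · intro W hW
    rw [pts_univ, pts_univ, (mem_cov.mp hW).2.2, sum_range_succ]
    push_cast; ring

/-- The subspaces between `U` and `X` of dimension two more than `U`. -/
noncomputable def cov2 (U X : Submodule F V) : Finset (Submodule F V) :=
  univ.filter (fun W => U ≤ W ∧ W ≤ X ∧ finrank F W = finrank F U + 2)

lemma mem_cov2 {U X W : Submodule F V} :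
    W ∈ cov2 U X ↔ U ≤ W ∧ W ≤ X ∧ finrank F W = finrank F U + 2 := by simp [cov2]

lemma cov2_inc {U X W : Submodule F V} (hW : W ∈ cov U X) :
    (cov2 U X).filter (fun S => W ∈ cov U S) = cov W X := by
  ext S
  simp only [mem_filter, mem_cov2, mem_cov] at *
  constructor
  · rintro ⟨⟨h1, h2, h3⟩, h4, h5, h6⟩
    exact ⟨h5, h2, by omega⟩
  · rintro ⟨h1, h2, h3⟩
    exact ⟨⟨hW.1.trans h1, h2, by omega⟩, hW.1, h1, hW.2.2⟩

lemma finrank_cov_sup {U X W W' : Submodule F V} (hW : W ∈ cov U X) (hW' : W' ∈ cov U X) (hne : W ≠ W') :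
    finrank F ↥(W ⊔ W') = finrank F U + 2 := by
  rw [mem_cov] at *
  have h := Submodule.finrank_sup_add_finrank_inf_eq W W'
  have h1 : U ≤ W ⊓ W' := le_inf hW.1 hW'.1
  have h2 := Submodule.finrank_mono h1
  have h3 : finrank F ↥(W ⊓ W') ≠ finrank F U + 1 := by
    intro h4
    have e1 := Submodule.eq_of_le_of_finrank_eq (inf_le_left : W ⊓ W' ≤ W) (by omega)
    have e2 := Submodule.eq_of_le_of_finrank_eq (inf_le_right : W ⊓ W' ≤ W') (by omega)
    exact hne (e1.symm.trans e2)
  have h4 := Submodule.finrank_mono (inf_le_left : W ⊓ W' ≤ W)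
  omega

lemma cov2_inc2 {U X W W' : Submodule F V} (hW : W ∈ cov U X) (hW' : W' ∈ cov U X) (hne : W ≠ W') :
    (cov2 U X).filter (fun S => W ∈ cov U S ∧ W' ∈ cov U S) = {W ⊔ W'} := by
  have h0 := finrank_cov_sup hW hW' hne
  ext S
  simp only [mem_filter, mem_cov2, mem_cov, mem_singleton] at *
  constructor
  · rintro ⟨⟨h1, h2, h3⟩, ⟨h4, h5, h6⟩, ⟨h4, h5', h6⟩⟩
    exact (Submodule.eq_of_le_of_finrank_eq (sup_le h5 h5') (by omega)).symm
  · rintro rfl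
    exact ⟨⟨hW.1.trans le_sup_left, sup_le hW.2.1 hW'.2.1, h0⟩, ⟨hW.1, le_sup_left, hW.2.2⟩,
      ⟨hW'.1, le_sup_right, hW'.2.2⟩⟩

lemma cov_eq_filter {U X S : Submodule F V} (hS : S ≤ X) :
    cov U S = (cov U X).filter (fun W => W ∈ cov U S) := by
  ext W
  simp only [mem_filter, mem_cov]
  constructor
  · rintro ⟨h1, h2, h3⟩; exact ⟨⟨h1, h2.trans hS, h3⟩, h1, h2, h3⟩
  · exact fun h => h.2

lemma card_cov_one {U X : Submodule F V} (hUX : U ≤ X) (h : finrank F X = finrank F U + 1) :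
    (cov U X).card = 1 := by
  rw [card_cov hUX, h, Nat.add_sub_cancel_left]; simp
lemma card_cov_two {U X : Submodule F V} (hUX : U ≤ X) (h : finrank F X = finrank F U + 2) :
    (cov U X).card = Fintype.card F + 1 := by
  rw [card_cov hUX, h, Nat.add_sub_cancel_left]; simp [sum_range_succ]; ring
lemma card_cov_three {U X : Submodule F V} (hUX : U ≤ X) (h : finrank F X = finrank F U + 3) :
    (cov U X).card = Fintype.card F ^ 2 + Fintype.card F + 1 := by
  rw [card_cov hUX, h, Nat.add_sub_cancel_left]; simp [sum_range_succ]; ring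
lemma card_cov_four {U X : Submodule F V} (hUX : U ≤ X) (h : finrank F X = finrank F U + 4) :
    (cov U X).card = Fintype.card F ^ 3 + Fintype.card F ^ 2 + Fintype.card F + 1 := by
  rw [card_cov hUX, h, Nat.add_sub_cancel_left]; simp [sum_range_succ]; ring

lemma sum_cov2 {U X : Submodule F V} (h : finrank F X = finrank F U + 3)
    (w : Submodule F V → ℤ) :
    ∑ S ∈ cov2 U X, ∑ W ∈ cov U S, w W = (Fintype.card F + 1) * ∑ W ∈ cov U X, w W := by
  have e : ∀ S ∈ cov2 U X, ∑ W ∈ cov U S, w W = ∑ W ∈ cov U X, if W ∈ cov U S then w W else 0 := by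
    intro S hS
    rw [← sum_filter, ← cov_eq_filter (mem_cov2.mp hS).2.1]
  rw [sum_congr rfl e, sum_comm, mul_sum]
  apply sum_congr rfl
  intro W hW
  rw [← sum_filter, cov2_inc hW, sum_const, card_cov_two (mem_cov.mp hW).2.1 (by
    have := (mem_cov.mp hW).2.2; omega)]
  simp

lemma sum_sq_cov2 {U X : Submodule F V} (h : finrank F X = finrank F U + 3)
    (w : Submodule F V → ℤ) :
    ∑ S ∈ cov2 U X, (∑ W ∈ cov U S, w W) ^ 2 =
      Fintype.card F * ∑ W ∈ cov U X, w W ^ 2 + (∑ W ∈ cov U X, w W) ^ 2 := by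
  have e : ∀ S ∈ cov2 U X, (∑ W ∈ cov U S, w W) ^ 2 =
      ∑ W ∈ cov U X, ∑ W' ∈ cov U X, if W ∈ cov U S ∧ W' ∈ cov U S then w W * w W' else 0 := by
    intro S hS
    rw [sq, sum_mul_sum, cov_eq_filter (mem_cov2.mp hS).2.1, sum_filter]
    apply sum_congr rfl
    intro W hW
    rw [sum_filter]
    split_ifs with h1
    · rw [← cov_eq_filter (mem_cov2.mp hS).2.1] at *
      simp [h1]
    · rw [← cov_eq_filter (mem_cov2.mp hS).2.1] at *
      simp [h1]
  rw [sum_congr rfl e, sum_comm, sq (∑ W ∈ cov U X, w W), sum_mul_sum, mul_sum, ← sum_add_distrib]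
  apply sum_congr rfl
  intro W hW
  rw [sum_comm, ← add_sum_erase _ _ hW, ← add_sum_erase (a := W) _ (fun j => w W * w j) hW, ← add_assoc]
  congr 1
  · rw [← sum_filter]
    simp only [and_self]
    rw [cov2_inc hW, sum_const, card_cov_two (mem_cov.mp hW).2.1 (by
    have := (mem_cov.mp hW).2.2; omega)]
    simp only [nsmul_eq_mul]; push_cast; ring
  · apply sum_congr rfl
    intro W' hW'
    rw [← sum_filter, cov2_inc2 hW (mem_of_mem_erase hW') (ne_of_mem_erase hW').symm, sum_singleton]

lemma card_cov2 {U X : Submodule F V} (hUX : U ≤ X) (h : finrank F X = finrank F U + 3) :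
    (cov2 U X).card = Fintype.card F ^ 2 + Fintype.card F + 1 := by
  have h1 := sum_cov2 h (fun _ => 1)
  simp only [sum_const, nsmul_eq_mul, mul_one] at h1
  rw [card_cov_three hUX h, sum_congr rfl (g := fun _ => (Fintype.card F : ℤ) + 1)] at h1
  · rw [sum_const, nsmul_eq_mul, mul_comm] at h1
    have h2 : (Fintype.card F : ℤ) + 1 ≠ 0 := by positivity
    exact_mod_cast mul_left_cancel₀ h2 h1
  · intro S hS
    rw [mem_cov2] at hS
    rw [card_cov_two hS.1 hS.2.2]; push_cast; ring

end geo
end CapAux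

namespace CapAux

/-! ### Part 3: caps and their tangents -/

section cap
set_option linter.unusedSectionVars false
open Classical Finset
open scoped LinearAlgebra.Projectivization

variable {F : Type*} [Field F] [Fintype F] {V : Type*} [AddCommGroup V] [Module F V]
  [FiniteDimensional F V] [Fintype (ℙ F V)] [Fintype (Submodule F V)]

/-- No three points collinear. -/
def CapF (K : Finset (ℙ F V)) : Prop :=
  ∀ P ∈ K, ∀ Q ∈ K, ∀ R ∈ K, P ≠ Q → P ≠ R → Q ≠ R → ¬ R.submodule ≤ P.submodule ⊔ Q.submodule

/-- Points of contact of the tangents through `N`. -/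
noncomputable def tanPts (K : Finset (ℙ F V)) (N : ℙ F V) : Finset (ℙ F V) :=
  K.filter (fun P => ∀ Q ∈ K, Q.submodule ≤ N.submodule ⊔ P.submodule → Q = P)

/-- Tangents at `P` in `X`. -/
noncomputable def tang (K : Finset (ℙ F V)) (P : ℙ F V) (X : Submodule F V) : Finset (Submodule F V) :=
  (cov P.submodule X).filter (fun l => ∀ Q ∈ K, Q.submodule ≤ l → Q = P)

variable {K : Finset (ℙ F V)}

lemma mem_tanPts {N P : ℙ F V} : P ∈ tanPts K N ↔
    P ∈ K ∧ ∀ Q ∈ K, Q.submodule ≤ N.submodule ⊔ P.submodule → Q = P := by simp [tanPts]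

lemma tanPts_subset (N : ℙ F V) : tanPts K N ⊆ K := filter_subset _ _

lemma pts_le_of_subset {A B : Finset (ℙ F V)} (h : A ⊆ B) (W : Submodule F V) : pts A W ≤ pts B W :=
  card_le_card (filter_subset_filter _ h)

lemma pts_top (A : Finset (ℙ F V)) : pts A ⊤ = A.card := by
  unfold pts inc; simp

lemma pts_pt {P : ℙ F V} (hP : P ∈ K) : pts K P.submodule = 1 := by
  unfold pts
  rw [card_eq_one]
  refine ⟨P, ?_⟩
  ext Q
  rw [mem_inc, mem_singleton]
  constructor
  · rintro ⟨_, h⟩; exact pt_le_pt h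
  · rintro rfl; exact ⟨hP, le_rfl⟩

lemma pts_pt_not {P : ℙ F V} (hP : P ∉ K) : pts K P.submodule = 0 := by
  unfold pts
  rw [card_eq_zero, eq_empty_iff_forall_notMem]
  intro Q hQ
  rw [mem_inc] at hQ
  exact hP (pt_le_pt hQ.2 ▸ hQ.1)

lemma pts_pair (hK : CapF K) {P Q : ℙ F V} (hP : P ∈ K) (hQ : Q ∈ K) (h : P ≠ Q) :
    pts K (P.submodule ⊔ Q.submodule) = 2 := by
  unfold pts
  rw [card_eq_two]
  refine ⟨P, Q, h, ?_⟩
  ext R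
  simp only [mem_inc, mem_insert, mem_singleton]
  constructor
  · rintro ⟨h1, h2⟩
    by_contra h3
    push Not at h3
    exact hK P hP Q hQ R h1 h h3.1.symm h3.2.symm h2
  · rintro (rfl | rfl)
    · exact ⟨hP, le_sup_left⟩
    · exact ⟨hQ, le_sup_right⟩

lemma pts_tang {P : ℙ F V} (hP : P ∈ K) {l : Submodule F V} (hl : P.submodule ≤ l)
    (h : ∀ Q ∈ K, Q.submodule ≤ l → Q = P) : pts K l = 1 := by
  unfold pts
  rw [card_eq_one]
  refine ⟨P, ?_⟩
  ext Q
  rw [mem_inc, mem_singleton]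
  constructor
  · rintro ⟨h1, h2⟩; exact h Q h1 h2
  · rintro rfl; exact ⟨hP, hl⟩

lemma line_eq {P Q : ℙ F V} {l : Submodule F V} (h : P ≠ Q) (hP : P.submodule ≤ l) (hQ : Q.submodule ≤ l)
    (hl : finrank F l = 2) : P.submodule ⊔ Q.submodule = l :=
  Submodule.eq_of_le_of_finrank_eq (sup_le hP hQ) (by rw [finrank_line h, hl])

lemma card_tang (hK : CapF K) {P : ℙ F V} (hP : P ∈ K) {X : Submodule F V} (hPX : P.submodule ≤ X) :
    ((tang K P X).card : ℤ) = (cov P.submodule X).card - (pts K X - 1) := by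
  have h := sum_cov K hPX
  rw [pts_pt hP] at h
  have e : ∀ l ∈ cov P.submodule X, ((pts K l : ℤ) - (1 : ℕ)) =
      1 - (if (∀ Q ∈ K, Q.submodule ≤ l → Q = P) then 1 else 0) := by
    intro l hl
    rw [mem_cov, P.finrank_submodule] at hl
    split_ifs with h1
    · rw [pts_tang hP hl.1 h1]; rfl
    · push Not at h1
      obtain ⟨Q, hQ, hQl, hne⟩ := h1
      rw [← line_eq hne.symm hl.1 hQl hl.2.2, pts_pair hK hP hQ hne.symm]; rfl
  rw [sum_congr rfl e, sum_sub_distrib, sum_const, ← sum_filter, sum_const] at h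
  simp only [nsmul_eq_mul, mul_one] at h
  unfold tang
  push_cast at h
  linarith

lemma contact_card {P : ℙ F V} (hP : P ∈ K) {X : Submodule F V} (hPX : P.submodule ≤ X) :
    ((univ.filter (fun N => N ∉ K ∧ N.submodule ≤ X ∧ P ∈ tanPts K N)).card) =
      (tang K P X).card * Fintype.card F := by
  rw [card_eq_sum_card_fiberwise (f := fun N : ℙ F V => P.submodule ⊔ N.submodule) (t := tang K P X)]
  · apply sum_const_nat
    intro l hl
    have hl' := hl
    simp only [tang, mem_filter] at hl
    have hlc := mem_cov.mp hl.1
    rw [P.finrank_submodule] at hlc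
    have e : (univ.filter (fun N => N ∉ K ∧ N.submodule ≤ X ∧ P ∈ tanPts K N)).filter
      (fun N : ℙ F V => P.submodule ⊔ N.submodule = l) =
      inc univ l \ inc univ P.submodule := by
      ext N
      simp only [mem_filter, mem_univ, true_and, mem_sdiff, mem_inc]
      constructor
      · rintro ⟨⟨h1, h2, h3⟩, rfl⟩
        refine ⟨le_sup_right, fun h => h1 (pt_le_pt h ▸ hP)⟩
      · rintro ⟨h1, h2⟩
        have hne : P ≠ N := by rintro rfl; exact h2 le_rfl
        have hle := line_eq hne hlc.1 h1 hlc.2.2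
        refine ⟨⟨fun h => hne (hl.2 N h h1).symm, h1.trans hlc.2.1, ?_⟩, hle⟩
        rw [mem_tanPts, sup_comm, hle]
        exact ⟨hP, hl.2⟩
    rw [e, card_sdiff_of_subset (inc_mono hlc.1)]
    change pts univ l - pts univ P.submodule = _
    rw [pts_univ, pts_univ, hlc.2.2, P.finrank_submodule, sum_range_succ]; simp
  · intro N hN
    simp only [coe_filter, mem_univ, true_and, Set.mem_ofPred_eq, mem_tanPts] at hN
    simp only [tang, coe_filter, Set.mem_ofPred_eq]
    refine ⟨sup_mem_cov hPX hN.2.1 (fun h => hN.1 (pt_le_pt h ▸ hP)), ?_⟩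
    rw [sup_comm]; exact hN.2.2.2

lemma sum_contact (X : Submodule F V) :
    ∑ N ∈ univ.filter (fun N => N ∉ K ∧ N.submodule ≤ X), pts (tanPts K N) X =
    ∑ P ∈ inc K X, (univ.filter (fun N => N ∉ K ∧ N.submodule ≤ X ∧ P ∈ tanPts K N)).card := by
  have e1 : ∀ N : ℙ F V, pts (tanPts K N) X = ∑ P ∈ inc K X, if P ∈ tanPts K N then 1 else 0 := by
    intro N
    rw [sum_boole]
    unfold pts
    simp only [Nat.cast_id]
    congr 1
    ext P
    simp only [mem_inc, mem_filter]
    constructor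
    · rintro ⟨h1, h2⟩; exact ⟨⟨tanPts_subset _ h1, h2⟩, h1⟩
    · rintro ⟨⟨_, h2⟩, h1⟩; exact ⟨h1, h2⟩
  rw [sum_congr rfl (fun N _ => e1 N), sum_comm]
  apply sum_congr rfl
  intro P _
  rw [sum_boole]
  simp only [filter_filter, Nat.cast_id]
  congr 1
  ext N; simp only [mem_filter, and_assoc]

lemma contact2_card (hK : CapF K) {P Q : ℙ F V} (hP : P ∈ K) (hQ : Q ∈ K) (hne : P ≠ Q) {X : Submodule F V}
    (hPX : P.submodule ≤ X) (hQX : Q.submodule ≤ X) (hX : finrank F X = 3) :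
    ((univ.filter (fun N => N ∉ K ∧ N.submodule ≤ X ∧ P ∈ tanPts K N ∧ Q ∈ tanPts K N)).card) =
      (tang K P X).card * (tang K Q X).card := by
  rw [← card_product]
  have hnle : ∀ N : ℙ F V, N ∉ K → P ∈ tanPts K N → ¬ Q.submodule ≤ P.submodule ⊔ N.submodule := by
    intro N _ hN h
    rw [sup_comm] at h
    exact hne.symm ((mem_tanPts.mp hN).2 Q hQ h)
  have hmt : ∀ N R : ℙ F V, N ∉ K → R ∈ K → N.submodule ≤ X → R.submodule ≤ X → R ∈ tanPts K N →
      R.submodule ⊔ N.submodule ∈ tang K R X := by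
    intro N R hN hR hNX hRX h
    simp only [tang, mem_filter]
    refine ⟨sup_mem_cov hRX hNX (fun h => hN (pt_le_pt h ▸ hR)), ?_⟩
    rw [sup_comm]; exact (mem_tanPts.mp h).2
  have hinf : ∀ l ∈ tang K P X, ∀ l' ∈ tang K Q X, finrank F ↥(l ⊓ l') = 1 := by
    intro l hl l' hl'
    simp only [tang, mem_filter, mem_cov, P.finrank_submodule, Q.finrank_submodule] at hl hl'
    have h1 := Submodule.finrank_sup_add_finrank_inf_eq l l'
    have h2 := Submodule.finrank_mono (sup_le hl.1.2.1 hl'.1.2.1)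
    have h3 := Submodule.finrank_mono (inf_le_left : l ⊓ l' ≤ l)
    have h4 : finrank F ↥(l ⊓ l') ≠ 2 := by
      intro h4
      have := Submodule.eq_of_le_of_finrank_eq (inf_le_left : l ⊓ l' ≤ l) (by omega)
      have hPl' : P.submodule ≤ l' := hl.1.1.trans (this ▸ inf_le_right)
      exact hne (hl'.2 P hP hPl')
    omega
  apply card_bij (fun N _ => (P.submodule ⊔ N.submodule, Q.submodule ⊔ N.submodule))
  · intro N hN
    simp only [mem_filter, mem_univ, true_and] at hN
    rw [mem_product]
    exact ⟨hmt N P hN.1 hP hN.2.1 hPX hN.2.2.1, hmt N Q hN.1 hQ hN.2.1 hQX hN.2.2.2⟩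
  · intro N hN N' hN' h
    simp only [mem_filter, mem_univ, true_and] at hN hN'
    simp only [Prod.mk.injEq] at h
    have h0 := hinf _ (hmt N P hN.1 hP hN.2.1 hPX hN.2.2.1) _ (hmt N Q hN.1 hQ hN.2.1 hQX hN.2.2.2)
    have e1 := Submodule.eq_of_le_of_finrank_eq (le_inf le_sup_right le_sup_right :
      N.submodule ≤ (P.submodule ⊔ N.submodule) ⊓ (Q.submodule ⊔ N.submodule)) (by
      rw [h0, N.finrank_submodule])
    have e2 : N'.submodule ≤ (P.submodule ⊔ N.submodule) ⊓ (Q.submodule ⊔ N.submodule) := by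
      rw [h.1, h.2]; exact le_inf le_sup_right le_sup_right
    rw [← e1] at e2
    exact (pt_le_pt e2).symm
  · rintro ⟨l, l'⟩ hb
    rw [mem_product] at hb
    have h0 := hinf _ hb.1 _ hb.2
    obtain ⟨hl, hl'⟩ := hb
    simp only [tang, mem_filter, mem_cov, P.finrank_submodule, Q.finrank_submodule] at hl hl'
    set N := Projectivization.mk'' (l ⊓ l') h0 with hN
    have hNs : N.submodule = l ⊓ l' := Projectivization.submodule_mk'' _ _
    have hNl : N.submodule ≤ l := hNs ▸ inf_le_left
    have hNl' : N.submodule ≤ l' := hNs ▸ inf_le_right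
    have hPN : P ≠ N := by
      rintro h; rw [← h] at hNl'; exact hne (hl'.2 P hP hNl')
    have hQN : Q ≠ N := by
      rintro h; rw [← h] at hNl; exact hne.symm (hl.2 Q hQ hNl)
    have e1 := line_eq hPN hl.1.1 hNl hl.1.2.2
    have e2 := line_eq hQN hl'.1.1 hNl' hl'.1.2.2
    refine ⟨N, ?_, by rw [e1, e2]⟩
    simp only [mem_filter, mem_univ, true_and, mem_tanPts]
    refine ⟨fun h => hPN (hl.2 N h hNl).symm, hNl.trans hl.1.2.1, ⟨hP, ?_⟩, hQ, ?_⟩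
    · rw [sup_comm, e1]; exact hl.2
    · rw [sup_comm, e2]; exact hl'.2

/-- The defect of a plane. -/
noncomputable def dd (K : Finset (ℙ F V)) (X : Submodule F V) : ℤ := Fintype.card F + 2 - pts K X

lemma card_tang_plane (hK : CapF K) {P : ℙ F V} (hP : P ∈ K) {X : Submodule F V} (hPX : P.submodule ≤ X)
    (hX : finrank F X = 3) : ((tang K P X).card : ℤ) = dd K X := by
  rw [card_tang hK hP hPX, card_cov_two hPX (by rw [hX, P.finrank_submodule])]
  unfold dd; push_cast; ring

lemma dd_nonneg (hK : CapF K) {X : Submodule F V} (hX : finrank F X = 3) : 0 ≤ dd K X := by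
  by_cases h : ∃ P ∈ K, P.submodule ≤ X
  · obtain ⟨P, hP, hPX⟩ := h
    rw [← card_tang_plane hK hP hPX hX]; positivity
  · push Not at h
    have : pts K X = 0 := by
      unfold pts inc; rw [card_eq_zero, filter_eq_empty_iff]; exact fun P hP => h P hP
    have h0 : (0 : ℤ) ≤ Fintype.card F := by positivity
    unfold dd; rw [this]; push_cast; linarith

lemma plane_contact (hK : CapF K) {X : Submodule F V} (hX : finrank F X = 3) :
    ∑ N ∈ univ.filter (fun N => N ∉ K ∧ N.submodule ≤ X), (pts (tanPts K N) X : ℤ) =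
      pts K X * dd K X * Fintype.card F := by
  have h := sum_contact (K := K) X
  have h' := congrArg (fun n : ℕ => (n : ℤ)) h
  simp only [Nat.cast_sum] at h'
  rw [h', sum_congr rfl (g := fun _ => dd K X * Fintype.card F)]
  · rw [sum_const, nsmul_eq_mul]; unfold pts; ring
  · intro P hP
    rw [mem_inc] at hP
    rw [contact_card hP.1 hP.2, Nat.cast_mul, card_tang_plane hK hP.1 hP.2 hX]

lemma card_offDiag_cast {α : Type*} [DecidableEq α] (s : Finset α) :
    ((s.offDiag).card : ℤ) = s.card * (s.card - 1) := by
  rw [offDiag_card, Nat.cast_sub (Nat.le_mul_self _)]; push_cast; ring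

lemma plane_contact2 (hK : CapF K) {X : Submodule F V} (hX : finrank F X = 3) :
    ∑ N ∈ univ.filter (fun N => N ∉ K ∧ N.submodule ≤ X),
      ((pts (tanPts K N) X : ℤ) * (pts (tanPts K N) X - 1)) =
      pts K X * (pts K X - 1) * dd K X ^ 2 := by
  have e1 : ∀ N : ℙ F V, ((pts (tanPts K N) X : ℤ) * (pts (tanPts K N) X - 1)) =
      ∑ z ∈ (inc K X).offDiag, if (z.1 ∈ tanPts K N ∧ z.2 ∈ tanPts K N) then 1 else 0 := by
    intro N
    unfold pts
    rw [← card_offDiag_cast, sum_boole]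
    congr 2
    ext ⟨P, Q⟩
    simp only [mem_offDiag, mem_inc, mem_filter]
    constructor
    · rintro ⟨⟨h1, h2⟩, ⟨h3, h4⟩, h5⟩
      exact ⟨⟨⟨tanPts_subset _ h1, h2⟩, ⟨tanPts_subset _ h3, h4⟩, h5⟩, h1, h3⟩
    · rintro ⟨⟨⟨h1, h2⟩, ⟨h3, h4⟩, h5⟩, h6, h7⟩
      exact ⟨⟨h6, h2⟩, ⟨h7, h4⟩, h5⟩
  rw [sum_congr rfl (fun N _ => e1 N), sum_comm, sum_congr rfl (g := fun _ => dd K X ^ 2)]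
  · rw [sum_const, nsmul_eq_mul, card_offDiag_cast]; rfl
  · rintro ⟨P, Q⟩ hz
    simp only [mem_offDiag, mem_inc] at hz
    obtain ⟨⟨h1, h2⟩, ⟨h3, h4⟩, h5⟩ := hz
    rw [sum_boole, filter_filter]
    have := contact2_card hK h1 h3 h5 h2 h4 hX
    have e : (univ.filter (fun N => (N ∉ K ∧ N.submodule ≤ X) ∧ P ∈ tanPts K N ∧ Q ∈ tanPts K N)) =
      (univ.filter (fun N => N ∉ K ∧ N.submodule ≤ X ∧ P ∈ tanPts K N ∧ Q ∈ tanPts K N)) := by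
      ext N; simp only [mem_filter, and_assoc]
    rw [e, this]
    push_cast
    rw [card_tang_plane hK h1 h2 hX, card_tang_plane hK h3 h4 hX]; ring

/-- The planes. -/
noncomputable def planes (F V : Type*) [Field F] [AddCommGroup V] [Module F V] [Fintype (Submodule F V)] :
    Finset (Submodule F V) := univ.filter (fun X => finrank F X = 3)

lemma mem_planes {X : Submodule F V} : X ∈ planes F V ↔ finrank F X = 3 := by simp [planes]

/-- Weighted sum over planes. -/
noncomputable def EE (K : Finset (ℙ F V)) (f : Submodule F V → ℤ) : ℤ :=
  ∑ X ∈ planes F V, (pts K X : ℤ) * (pts K X - 1) * f X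

lemma EE_eq (f : Submodule F V → ℤ) :
    ∑ z ∈ K.offDiag, ∑ X ∈ cov (z.1.submodule ⊔ z.2.submodule) ⊤, f X = EE K f := by
  have e : ∀ z ∈ K.offDiag, ∑ X ∈ cov (z.1.submodule ⊔ z.2.submodule) ⊤, f X =
      ∑ X ∈ planes F V, if z.1.submodule ≤ X ∧ z.2.submodule ≤ X then f X else 0 := by
    rintro ⟨P, Q⟩ hz
    rw [mem_offDiag] at hz
    rw [← sum_filter]
    apply sum_congr _ (fun _ _ => rfl)
    ext X
    simp only [mem_cov, finrank_line hz.2.2, mem_filter, mem_planes, sup_le_iff, le_top, true_and]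
    tauto
  rw [sum_congr rfl e, sum_comm]
  apply sum_congr rfl
  intro X _
  unfold pts
  rw [← card_offDiag_cast, ← sum_filter, sum_const, nsmul_eq_mul]
  congr 3
  ext ⟨P, Q⟩
  simp only [mem_offDiag, mem_inc, mem_filter]
  tauto

end cap
end CapAux

namespace CapAux

/-! ### Part 4: the tangent lemma and its consequences -/

section tan
set_option linter.unusedSectionVars false
open Classical Finset
open scoped LinearAlgebra.Projectivization

variable {F : Type*} [Field F] [Fintype F] {V : Type*} [AddCommGroup V] [Module F V]
  [FiniteDimensional F V] [Fintype (ℙ F V)] [Fintype (Submodule F V)]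
variable {K : Finset (ℙ F V)}

lemma D3_ne_iff (a b c : Fin 3 → F) : D3 a b c ≠ 0 ↔ LinearIndependent F ![a, b, c] := by
  have h : LinearIndependent F (Matrix.of ![a, b, c]).row ↔ IsUnit (Matrix.of ![a, b, c]) :=
    Matrix.linearIndependent_rows_iff_isUnit
  rw [Matrix.isUnit_iff_isUnit_det, isUnit_iff_ne_zero, Matrix.det_fin_three] at h
  have e : D3 a b c ≠ 0 ↔ LinearIndependent F (Matrix.of ![a, b, c]).row := by
    rw [h]
    have : D3 a b c = (Matrix.of ![a, b, c]) 0 0 * (Matrix.of ![a, b, c]) 1 1 * (Matrix.of ![a, b, c]) 2 2 - (Matrix.of ![a, b, c]) 0 0 * (Matrix.of ![a, b, c]) 1 2 * (Matrix.of ![a, b, c]) 2 1 -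
      (Matrix.of ![a, b, c]) 0 1 * (Matrix.of ![a, b, c]) 1 0 * (Matrix.of ![a, b, c]) 2 2 + (Matrix.of ![a, b, c]) 0 1 * (Matrix.of ![a, b, c]) 1 2 * (Matrix.of ![a, b, c]) 2 0 +
      (Matrix.of ![a, b, c]) 0 2 * (Matrix.of ![a, b, c]) 1 0 * (Matrix.of ![a, b, c]) 2 1 - (Matrix.of ![a, b, c]) 0 2 * (Matrix.of ![a, b, c]) 1 1 * (Matrix.of ![a, b, c]) 2 0 := by
      simp [D3]; ring
    rw [this]
  exact e

lemma indep_iff (P Q R : ℙ F V) : LinearIndependent F ![P.rep, Q.rep, R.rep] ↔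
    finrank F ↥(P.submodule ⊔ Q.submodule ⊔ R.submodule) = 3 := by
  rw [linearIndependent_iff_card_eq_finrank_span, Fintype.card_fin, Set.finrank]
  have : Submodule.span F (Set.range ![P.rep, Q.rep, R.rep]) = P.submodule ⊔ Q.submodule ⊔ R.submodule := by
    rw [P.submodule_eq, Q.submodule_eq, R.submodule_eq, ← Submodule.span_union, ← Submodule.span_union]
    congr 1
    ext x
    simp
  rw [this, eq_comm]

lemma finrank_three {P Q R : ℙ F V} (h1 : P ≠ Q) (h2 : ¬ R.submodule ≤ P.submodule ⊔ Q.submodule) :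
    finrank F ↥(P.submodule ⊔ Q.submodule ⊔ R.submodule) = 3 := by
  rw [finrank_sup_pt h2, finrank_line h1]

/-- The tangent lemma in a plane. -/
lemma tangent_lemma (h2 : (2 : F) = 0) (hK : CapF K) {X : Submodule F V} (hX : finrank F X = 3)
    {N : ℙ F V} (hN : N ∉ K) (hNX : N.submodule ≤ X) {Q : ℙ F V} (hQ : Q ∈ K) (hQX : Q.submodule ≤ X)
    (hQt : Q ∉ tanPts K N) : pts (tanPts K N) X + pts K X ≤ Fintype.card F + 2 := by
  have hQ' : ∃ R ∈ K, R.submodule ≤ N.submodule ⊔ Q.submodule ∧ R ≠ Q := by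
    by_contra h
    push Not at h
    exact hQt (mem_tanPts.mpr ⟨hQ, h⟩)
  obtain ⟨R, hR, hRl, hRQ⟩ := hQ'
  have hNQ : N ≠ Q := by rintro rfl; exact hN hQ
  have hNR : N ≠ R := by rintro rfl; exact hN hR
  have hlNQ : N.submodule ⊔ Q.submodule = Q.submodule ⊔ R.submodule :=
    (line_eq hRQ.symm le_sup_right hRl (finrank_line hNQ)).symm
  have hRX : R.submodule ≤ X := hRl.trans (sup_le hNX hQX)
  have hRt : R ∉ tanPts K N := by
    intro h
    apply hRQ
    refine ((mem_tanPts.mp h).2 Q hQ ?_).symm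
    rw [line_eq hNR le_sup_left hRl (finrank_line hNQ)]; exact le_sup_right
  by_cases hm : pts K X ≤ 2
  · have h0 : pts K X = 2 := by
      apply le_antisymm hm
      have : ({Q, R} : Finset (ℙ F V)) ⊆ inc K X := by
        intro P hP
        simp only [mem_insert, mem_singleton] at hP
        rcases hP with rfl | rfl
        · exact mem_inc.mpr ⟨hQ, hQX⟩
        · exact mem_inc.mpr ⟨hR, hRX⟩
      have := card_le_card this
      rwa [card_pair hRQ.symm] at this
    have h1 : inc K X = {Q, R} := by
      symm
      apply eq_of_subset_of_card_le
      · intro P hP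
        simp only [mem_insert, mem_singleton] at hP
        rcases hP with rfl | rfl
        · exact mem_inc.mpr ⟨hQ, hQX⟩
        · exact mem_inc.mpr ⟨hR, hRX⟩
      · rw [card_pair hRQ.symm]; exact hm
    have h3 : pts (tanPts K N) X = 0 := by
      unfold pts
      rw [card_eq_zero, eq_empty_iff_forall_notMem]
      intro P hP
      rw [mem_inc] at hP
      have : P ∈ inc K X := mem_inc.mpr ⟨tanPts_subset _ hP.1, hP.2⟩
      rw [h1] at this
      simp only [mem_insert, mem_singleton] at this
      rcases this with rfl | rfl
      · exact hQt hP.1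
      · exact hRt hP.1
    omega
  · push Not at hm
    have e : X ≃ₗ[F] (Fin 3 → F) := LinearEquiv.ofFinrankEq _ _ (by rw [hX]; simp)
    have hrep : ∀ P : ℙ F V, P.submodule ≤ X → P.rep ∈ X := by
      intro P hP
      rw [P.submodule_eq, Submodule.span_singleton_le_iff_mem] at hP; exact hP
    set cd : ∀ P : ℙ F V, P.submodule ≤ X → (Fin 3 → F) := fun P hP => e ⟨P.rep, hrep P hP⟩ with hcd
    have hD : ∀ (A B C : ℙ F V) (hA : A.submodule ≤ X) (hB : B.submodule ≤ X) (hC : C.submodule ≤ X),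
        D3 (cd A hA) (cd B hB) (cd C hC) ≠ 0 ↔
        finrank F ↥(A.submodule ⊔ B.submodule ⊔ C.submodule) = 3 := by
      intro A B C hA hB hC
      rw [D3_ne_iff, ← indep_iff]
      have i1 := LinearMap.linearIndependent_iff (v := ![(⟨A.rep, hrep A hA⟩ : X), ⟨B.rep, hrep B hB⟩, ⟨C.rep, hrep C hC⟩])
        (e : X →ₗ[F] (Fin 3 → F)) e.ker
      have i2 := LinearMap.linearIndependent_iff (v := ![(⟨A.rep, hrep A hA⟩ : X), ⟨B.rep, hrep B hB⟩, ⟨C.rep, hrep C hC⟩])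
        X.subtype X.ker_subtype
      have j1 : (e : X →ₗ[F] (Fin 3 → F)) ∘ ![(⟨A.rep, hrep A hA⟩ : X), ⟨B.rep, hrep B hB⟩, ⟨C.rep, hrep C hC⟩]
        = ![cd A hA, cd B hB, cd C hC] := by
        funext i; fin_cases i <;> rfl
      have j2 : X.subtype ∘ ![(⟨A.rep, hrep A hA⟩ : X), ⟨B.rep, hrep B hB⟩, ⟨C.rep, hrep C hC⟩]
        = ![A.rep, B.rep, C.rep] := by
        funext i; fin_cases i <;> rfl
      rw [j1] at i1
      rw [j2] at i2
      exact i1.trans i2.symm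
    have hmem : ∀ P : {P // P ∈ inc K X}, P.1.submodule ≤ X := fun P => (mem_inc.mp P.2).2
    have hcard : Fintype.card {P // P ∈ inc K X} = pts K X := by
      rw [Fintype.card_coe]; rfl
    have hNmem : N.rep ∈ Q.submodule ⊔ R.submodule := by
      have : N.submodule ≤ Q.submodule ⊔ R.submodule := hlNQ ▸ le_sup_left
      rwa [N.submodule_eq, Submodule.span_singleton_le_iff_mem] at this
    rw [Q.submodule_eq, R.submodule_eq, Submodule.mem_sup] at hNmem
    obtain ⟨y, hy, z, hz, hyz⟩ := hNmem
    rw [Submodule.mem_span_singleton] at hy hz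
    obtain ⟨σ, rfl⟩ := hy
    obtain ⟨ρ, rfl⟩ := hz
    have hρ : ρ ≠ 0 := by
      rintro rfl
      apply hNQ
      apply pt_le_pt
      rw [N.submodule_eq, Submodule.span_singleton_le_iff_mem, Q.submodule_eq, ← hyz, zero_smul, add_zero]
      exact Submodule.smul_mem _ _ (Submodule.mem_span_singleton_self _)
    have hmain := arc_tangents h2 (fun P : {P // P ∈ inc K X} => cd P.1 (hmem P)) (by
        intro i j k hij hik hjk
        rw [hD i.1 j.1 k.1 (hmem i) (hmem j) (hmem k)]
        have hij' : i.1 ≠ j.1 := fun h => hij (Subtype.ext h)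
        have hik' : i.1 ≠ k.1 := fun h => hik (Subtype.ext h)
        have hjk' : j.1 ≠ k.1 := fun h => hjk (Subtype.ext h)
        exact finrank_three hij' (hK _ (mem_inc.mp i.2).1 _ (mem_inc.mp j.2).1 _ (mem_inc.mp k.2).1 hij' hik' hjk'))
      (by rw [hcard]; exact hm) (cd N hNX) ⟨Q, mem_inc.mpr ⟨hQ, hQX⟩⟩ ⟨R, mem_inc.mpr ⟨hR, hRX⟩⟩
      (fun h => hRQ (congrArg Subtype.val h).symm) σ ρ (by
        simp only [hcd]
        rw [← map_smul, ← map_smul, ← map_add]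
        congr 1
        exact Subtype.ext hyz.symm) hρ (univ.filter (fun P => P.1 ∈ tanPts K N)) (by
        intro i hi s hs
        rw [mem_filter] at hi
        rw [hD i.1 N s.1 (hmem i) hNX (hmem s)]
        have hiN : i.1 ≠ N := by
          intro h; exact hN (h ▸ (mem_inc.mp i.2).1)
        apply finrank_three hiN
        intro h
        rw [sup_comm] at h
        exact hs (Subtype.ext ((mem_tanPts.mp hi.2).2 s.1 (mem_inc.mp s.2).1 h)))
    have hc2 : (univ.filter (fun P : {P // P ∈ inc K X} => P.1 ∈ tanPts K N)).card = pts (tanPts K N) X := by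
      unfold pts
      apply card_bij (fun P _ => P.1)
      · intro P hP
        rw [mem_filter] at hP
        exact mem_inc.mpr ⟨hP.2, hmem P⟩
      · intro P _ P' _ h; exact Subtype.ext h
      · intro P hP
        rw [mem_inc] at hP
        exact ⟨⟨P, mem_inc.mpr ⟨tanPts_subset _ hP.1, hP.2⟩⟩, mem_filter.mpr ⟨mem_univ _, hP.1⟩, rfl⟩
    rw [hc2, hcard] at hmain
    exact hmain

lemma tangent_sum (h2 : (2 : F) = 0) (hK : CapF K) {X : Submodule F V}
    {N : ℙ F V} (hN : N ∉ K) (hNX : N.submodule ≤ X) {Q : ℙ F V} (hQ : Q ∈ K) (hQX : Q.submodule ≤ X)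
    (hQt : Q ∉ tanPts K N) : (pts (tanPts K N) X : ℤ) + pts K X ≤
      2 + Fintype.card F * (cov (N.submodule ⊔ Q.submodule) X).card := by
  have hQ' : ∃ R ∈ K, R.submodule ≤ N.submodule ⊔ Q.submodule ∧ R ≠ Q := by
    by_contra h
    push Not at h
    exact hQt (mem_tanPts.mpr ⟨hQ, h⟩)
  obtain ⟨R, hR, hRl, hRQ⟩ := hQ'
  have hNQ : N ≠ Q := by rintro rfl; exact hN hQ
  have hlNQ : Q.submodule ⊔ R.submodule = N.submodule ⊔ Q.submodule :=
    (line_eq hRQ.symm le_sup_right hRl (finrank_line hNQ))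
  have hp2 : pts K (N.submodule ⊔ Q.submodule) = 2 := by
    rw [← hlNQ]; exact pts_pair hK hQ hR hRQ.symm
  have hp0 : pts (tanPts K N) (N.submodule ⊔ Q.submodule) = 0 := by
    unfold pts
    rw [card_eq_zero, eq_empty_iff_forall_notMem]
    intro P hP
    rw [mem_inc] at hP
    have hNP : N ≠ P := by rintro rfl; exact hN (tanPts_subset _ hP.1)
    have := line_eq hNP le_sup_left hP.2 (finrank_line hNQ)
    have hPQ := (mem_tanPts.mp hP.1).2 Q hQ (by rw [this]; exact le_sup_right)
    exact hQt (hPQ ▸ hP.1)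
  have s1 := sum_cov K (sup_le hNX hQX)
  have s2 := sum_cov (tanPts K N) (sup_le hNX hQX)
  rw [hp2] at s1
  rw [hp0] at s2
  have hle : ∑ W ∈ cov (N.submodule ⊔ Q.submodule) X, (((pts (tanPts K N) W : ℤ) - (0 : ℕ)) + ((pts K W : ℤ) - (2 : ℕ)))
      ≤ ∑ W ∈ cov (N.submodule ⊔ Q.submodule) X, (Fintype.card F : ℤ) := by
    apply sum_le_sum
    intro W hW
    rw [mem_cov, finrank_line hNQ] at hW
    have := tangent_lemma h2 hK hW.2.2 hN (le_sup_left.trans hW.1) hQ (le_sup_right.trans hW.1) hQt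
    push_cast
    have h3 : (pts (tanPts K N) W : ℤ) + pts K W ≤ Fintype.card F + 2 := by exact_mod_cast this
    linarith
  rw [sum_add_distrib, s1, s2, sum_const, nsmul_eq_mul] at hle
  push_cast at hle
  linarith

end tan
end CapAux

namespace CapAux

/-! ### Part 5: global counting in dimension four -/

section glob
set_option linter.unusedSectionVars false
open Classical Finset
open scoped LinearAlgebra.Projectivization

variable {F : Type*} [Field F] [Fintype F] {V : Type*} [AddCommGroup V] [Module F V]
  [FiniteDimensional F V] [Fintype (ℙ F V)] [Fintype (Submodule F V)]
variable {K : Finset (ℙ F V)}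

/-- Number of tangents at a point of the cap. -/
noncomputable def tt (K : Finset (ℙ F V)) : ℤ :=
  (Fintype.card F : ℤ) ^ 3 + (Fintype.card F : ℤ) ^ 2 + Fintype.card F + 2 - K.card

/-- Number of tangents at a point of the cap, inside a solid. -/
noncomputable def ts (K : Finset (ℙ F V)) (S : Submodule F V) : ℤ :=
  (Fintype.card F : ℤ) ^ 2 + Fintype.card F + 2 - pts K S

lemma finrank_top5 (hV : finrank F V = 5) : finrank F (⊤ : Submodule F V) = 5 := by
  rw [finrank_top, hV]

lemma tau_le (hV : finrank F V = 5) (h2 : (2 : F) = 0) (hK : CapF K) {N : ℙ F V} (hN : N ∉ K)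
    {Q : ℙ F V} (hQ : Q ∈ K) (hQt : Q ∉ tanPts K N) : ((tanPts K N).card : ℤ) ≤ tt K := by
  have h := tangent_sum h2 hK hN (le_top : _ ≤ (⊤ : Submodule F V)) hQ le_top hQt
  have hNQ : N ≠ Q := by rintro rfl; exact hN hQ
  rw [card_cov_three le_top (by rw [finrank_top5 hV, finrank_line hNQ]), pts_top, pts_top] at h
  unfold tt; push_cast at h; linarith

lemma solid_le (h2 : (2 : F) = 0) (hK : CapF K) {N : ℙ F V} (hN : N ∉ K) {S : Submodule F V}
    (hS : finrank F S = 4) (hNS : N.submodule ≤ S)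
    {Q : ℙ F V} (hQ : Q ∈ K) (hQS : Q.submodule ≤ S) (hQt : Q ∉ tanPts K N) :
    (pts (tanPts K N) S : ℤ) ≤ ts K S := by
  have h := tangent_sum h2 hK hN hNS hQ hQS hQt
  have hNQ : N ≠ Q := by rintro rfl; exact hN hQ
  rw [card_cov_two (sup_le hNS hQS) (by rw [hS, finrank_line hNQ])] at h
  unfold ts; push_cast at h; linarith

lemma card_tang_top (hV : finrank F V = 5) (hK : CapF K) {P : ℙ F V} (hP : P ∈ K) :
    ((tang K P ⊤).card : ℤ) = tt K := by
  rw [card_tang hK hP le_top, card_cov_four le_top (by rw [finrank_top5 hV, P.finrank_submodule]), pts_top]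
  unfold tt; push_cast; ring

lemma sum_tau (hV : finrank F V = 5) (hK : CapF K) :
    ∑ N ∈ univ.filter (fun N => N ∉ K), ((tanPts K N).card : ℤ) = K.card * tt K * Fintype.card F := by
  have h := sum_contact (K := K) ⊤
  have h' := congrArg (fun n : ℕ => (n : ℤ)) h
  simp only [Nat.cast_sum, le_top, and_true, true_and, pts_top] at h'
  rw [h', sum_congr rfl (g := fun _ => tt K * Fintype.card F)]
  · rw [sum_const, nsmul_eq_mul]
    have : (inc K (⊤ : Submodule F V)).card = K.card := pts_top K
    rw [this]; ring
  · intro P hP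
    rw [mem_inc] at hP
    have := contact_card hP.1 (le_top : _ ≤ (⊤ : Submodule F V))
    simp only [le_top, true_and] at this
    rw [this, Nat.cast_mul, card_tang_top hV hK hP.1]

lemma tau_planes {N : ℙ F V} (hN : N ∉ K) :
    ((tanPts K N).card : ℤ) * ((tanPts K N).card - 1) =
    ∑ X ∈ (planes F V).filter (fun X => N.submodule ≤ X),
      (pts (tanPts K N) X : ℤ) * (pts (tanPts K N) X - 1) := by
  have e1 : ∀ X : Submodule F V, ((pts (tanPts K N) X : ℤ) * (pts (tanPts K N) X - 1)) =
      ∑ z ∈ (tanPts K N).offDiag, if (z.1.submodule ≤ X ∧ z.2.submodule ≤ X) then 1 else 0 := by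
    intro X
    unfold pts
    rw [← card_offDiag_cast, sum_boole]
    congr 2
    ext ⟨P, Q⟩
    simp only [mem_offDiag, mem_inc, mem_filter]
    tauto
  rw [sum_congr rfl (fun X _ => e1 X), sum_comm, sum_congr rfl (g := fun _ => 1)]
  · rw [sum_const, ← card_offDiag_cast]; simp
  · rintro ⟨P, Q⟩ hz
    rw [mem_offDiag] at hz
    rw [sum_boole, filter_filter]
    have hPt := mem_tanPts.mp hz.1
    have hQt := mem_tanPts.mp hz.2.1
    have hPN : N ≠ P := fun h => hN (h ▸ hPt.1)
    have h3 := finrank_three hPN (fun h => hz.2.2 (hPt.2 Q hQt.1 h).symm)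
    have : ((planes F V).filter (fun X => N.submodule ≤ X ∧ P.submodule ≤ X ∧ Q.submodule ≤ X)) =
        {N.submodule ⊔ P.submodule ⊔ Q.submodule} := by
      ext X
      simp only [mem_filter, mem_planes, mem_singleton]
      constructor
      · rintro ⟨h4, h5, h6, h7⟩
        exact (Submodule.eq_of_le_of_finrank_eq (sup_le (sup_le h5 h6) h7) (by omega)).symm
      · rintro rfl
        exact ⟨h3, le_sup_left.trans le_sup_left, le_sup_right.trans le_sup_left, le_sup_right⟩
    rw [this]; simp

lemma sum_planes_swap (hK : CapF K) (g : Submodule F V → ℤ) :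
    ∑ N ∈ univ.filter (fun N => N ∉ K), ∑ X ∈ (planes F V).filter (fun X => N.submodule ≤ X),
      (pts (tanPts K N) X : ℤ) * (pts (tanPts K N) X - 1) * g X = EE K (fun X => dd K X ^ 2 * g X) := by
  have e : ∀ N : ℙ F V, ∑ X ∈ (planes F V).filter (fun X => N.submodule ≤ X),
      (pts (tanPts K N) X : ℤ) * (pts (tanPts K N) X - 1) * g X =
      ∑ X ∈ planes F V, if N.submodule ≤ X then
      (pts (tanPts K N) X : ℤ) * (pts (tanPts K N) X - 1) * g X else 0 := fun N => by rw [sum_filter]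
  rw [sum_congr rfl (fun N _ => e N), sum_comm]
  unfold EE
  apply sum_congr rfl
  intro X hX
  rw [← sum_filter, filter_filter, ← sum_mul, plane_contact2 hK (mem_planes.mp hX)]
  ring

lemma sum_tau2 (hK : CapF K) :
    ∑ N ∈ univ.filter (fun N => N ∉ K), ((tanPts K N).card : ℤ) * ((tanPts K N).card - 1) =
      EE K (fun X => dd K X ^ 2) := by
  have h := sum_planes_swap hK (fun _ => 1)
  simp only [mul_one] at h
  rw [← h]
  apply sum_congr rfl
  intro N hN
  exact tau_planes (mem_filter.mp hN).2

lemma sum_dd_cov (hK : CapF K) {P Q : ℙ F V} (hP : P ∈ K) (hQ : Q ∈ K) (hne : P ≠ Q) {X : Submodule F V}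
    (hX : P.submodule ⊔ Q.submodule ≤ X) :
    ∑ Y ∈ cov (P.submodule ⊔ Q.submodule) X, dd K Y =
      Fintype.card F * (cov (P.submodule ⊔ Q.submodule) X).card - (pts K X - 2) := by
  have h := sum_cov K hX
  rw [pts_pair hK hP hQ hne] at h
  have e : ∀ Y ∈ cov (P.submodule ⊔ Q.submodule) X, dd K Y = Fintype.card F - ((pts K Y : ℤ) - (2 : ℕ)) := by
    intro Y _; unfold dd; push_cast; ring
  rw [sum_congr rfl e, sum_sub_distrib, h, sum_const, nsmul_eq_mul]; push_cast; ring

lemma sum_dd_top (hV : finrank F V = 5) (hK : CapF K) {P Q : ℙ F V} (hP : P ∈ K) (hQ : Q ∈ K) (hne : P ≠ Q) :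
    ∑ Y ∈ cov (P.submodule ⊔ Q.submodule) ⊤, dd K Y = tt K := by
  rw [sum_dd_cov hK hP hQ hne le_top, card_cov_three le_top (by rw [finrank_top5 hV, finrank_line hne]),
    pts_top]
  unfold tt; push_cast; ring

lemma sum_dd_solid (hK : CapF K) {P Q : ℙ F V} (hP : P ∈ K) (hQ : Q ∈ K) (hne : P ≠ Q) {S : Submodule F V}
    (hS : P.submodule ⊔ Q.submodule ≤ S) (h4 : finrank F S = 4) :
    ∑ Y ∈ cov (P.submodule ⊔ Q.submodule) S, dd K Y = ts K S := by
  rw [sum_dd_cov hK hP hQ hne hS, card_cov_two hS (by rw [h4, finrank_line hne])]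
  unfold ts; push_cast; ring

lemma EE_one (hV : finrank F V = 5) :
    EE K (fun _ => 1) = K.card * (K.card - 1) * ((Fintype.card F : ℤ) ^ 2 + Fintype.card F + 1) := by
  rw [← EE_eq, sum_congr rfl (g := fun _ => ((Fintype.card F : ℤ) ^ 2 + Fintype.card F + 1))]
  · rw [sum_const, nsmul_eq_mul, card_offDiag_cast]
  · rintro ⟨P, Q⟩ hz
    rw [mem_offDiag] at hz
    rw [sum_const, card_cov_three le_top (by rw [finrank_top5 hV, finrank_line hz.2.2])]
    simp

lemma EE_dd (hV : finrank F V = 5) (hK : CapF K) :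
    EE K (fun X => dd K X) = K.card * (K.card - 1) * tt K := by
  rw [← EE_eq, sum_congr rfl (g := fun _ => tt K)]
  · rw [sum_const, nsmul_eq_mul, card_offDiag_cast]
  · rintro ⟨P, Q⟩ hz
    rw [mem_offDiag] at hz
    exact sum_dd_top hV hK hz.1 hz.2.1 hz.2.2

lemma EE_add (f g : Submodule F V → ℤ) : EE K (fun X => f X + g X) = EE K f + EE K g := by
  unfold EE; rw [← sum_add_distrib]; apply sum_congr rfl; intro X _; ring

lemma EE_smul (c : ℤ) (f : Submodule F V → ℤ) : EE K (fun X => c * f X) = c * EE K f := by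
  unfold EE; rw [mul_sum]; apply sum_congr rfl; intro X _; ring

lemma mm_nonneg (n : ℕ) : (0 : ℤ) ≤ (n : ℤ) * (n - 1) := by
  rcases n with _ | n
  · simp
  · push_cast; have : (0:ℤ) ≤ n := by positivity
    nlinarith

lemma EE_mono {f g : Submodule F V → ℤ} (h : ∀ X : Submodule F V, finrank F X = 3 → f X ≤ g X) : EE K f ≤ EE K g := by
  unfold EE
  apply sum_le_sum
  intro X hX
  exact mul_le_mul_of_nonneg_left (h X (mem_planes.mp hX)) (mm_nonneg _)

lemma EE_quad (hV : finrank F V = 5) (hK : CapF K) (a b : ℤ) :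
    EE K (fun X => (dd K X - a) * (dd K X - b)) = EE K (fun X => dd K X ^ 2) -
      K.card * (K.card - 1) * ((a + b) * tt K - a * b * ((Fintype.card F : ℤ) ^ 2 + Fintype.card F + 1)) := by
  have : (fun X => (dd K X - a) * (dd K X - b)) =
      fun X => dd K X ^ 2 + ((-(a + b)) * dd K X + (a * b) * 1) := by funext X; ring
  rw [this, EE_add, EE_add, EE_smul, EE_smul, EE_dd hV hK, EE_one hV]; ring

lemma int_prod_nonneg (d a : ℤ) : 0 ≤ (d - a) * (d - (a + 1)) := by
  rcases le_or_gt d a with h | h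
  · nlinarith
  · have : a + 1 ≤ d := h
    nlinarith

/-- nuclei of planes with small defect -/
lemma nucleus (h2 : (2 : F) = 0) (hK : CapF K) (hq : 2048 ≤ Fintype.card F) {X : Submodule F V}
    (hX : finrank F X = 3) (hd : dd K X = 1 ∨ dd K X = 2) :
    ∃ N : ℙ F V, N ∉ K ∧ N.submodule ≤ X ∧ inc K X ⊆ tanPts K N := by
  by_contra hcon
  push Not at hcon
  have hle : ∀ N ∈ univ.filter (fun N => N ∉ K ∧ N.submodule ≤ X),
      ((pts (tanPts K N) X : ℤ) * (pts (tanPts K N) X - 1)) ≤ (dd K X - 1) * (pts (tanPts K N) X : ℤ) := by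
    intro N hN
    simp only [mem_filter, mem_univ, true_and] at hN
    obtain ⟨Q, hQ, hQt⟩ := not_subset.mp (hcon N hN.1 hN.2)
    rw [mem_inc] at hQ
    have := tangent_lemma h2 hK hX hN.1 hN.2 hQ.1 hQ.2 hQt
    have h3 : (pts (tanPts K N) X : ℤ) ≤ dd K X := by unfold dd; have : (pts (tanPts K N) X : ℤ) + pts K X ≤ Fintype.card F + 2 := by exact_mod_cast this
                                                      linarith
    have h4 : (0 : ℤ) ≤ (pts (tanPts K N) X : ℤ) := by positivity
    nlinarith
  have h := sum_le_sum hle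
  rw [plane_contact2 hK hX, ← mul_sum, plane_contact hK hX] at h
  have hm : (pts K X : ℤ) = Fintype.card F + 2 - dd K X := by unfold dd; ring
  have hq' : (2048 : ℤ) ≤ Fintype.card F := by exact_mod_cast hq
  rw [hm] at h
  rcases hd with hd | hd
  · rw [hd] at h; nlinarith
  · rw [hd] at h; nlinarith

end glob
end CapAux

namespace CapAux

/-! ### Part 6: the possible values of the number of tangents -/

section vals
set_option linter.unusedSectionVars false
open Classical Finset
open scoped LinearAlgebra.Projectivization

variable {F : Type*} [Field F] [Fintype F] {V : Type*} [AddCommGroup V] [Module F V]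
  [FiniteDimensional F V] [Fintype (ℙ F V)] [Fintype (Submodule F V)]
variable {K : Finset (ℙ F V)}

lemma tt_nonneg (hV : finrank F V = 5) (hK : CapF K) {P : ℙ F V} (hP : P ∈ K) : 0 ≤ tt K := by
  rw [← card_tang_top hV hK hP]; positivity

lemma tt_ne_zero (hV : finrank F V = 5) (hK : CapF K) (hq : 2048 ≤ Fintype.card F)
    {P : ℙ F V} (hP : P ∈ K) : tt K ≠ 0 := by
  intro h0
  set q := Fintype.card F with hqdef
  have hno : ∀ R ∈ K, tang K R ⊤ = ∅ := by
    intro R hR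
    have := card_tang_top hV hK hR
    rw [h0] at this
    exact card_eq_zero.mp (by exact_mod_cast this)
  have hkz : (K.card : ℤ) = (q : ℤ) ^ 3 + (q : ℤ) ^ 2 + q + 2 := by
    unfold tt at h0; linarith
  have hk : K.card = q ^ 3 + q ^ 2 + q + 2 := by exact_mod_cast hkz
  have hplane : ∀ X : Submodule F V, finrank F X = 3 → pts K X = 0 ∨ pts K X = q + 2 := by
    intro X hX
    rcases Nat.eq_zero_or_pos (pts K X) with h | h
    · exact Or.inl h
    · right
      obtain ⟨R, hR⟩ := card_pos.mp h
      rw [mem_inc] at hR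
      have h1 := card_tang_plane hK hR.1 hR.2 hX
      have h2 : tang K R X ⊆ tang K R ⊤ := by
        intro l hl
        unfold tang at hl ⊢
        rw [mem_filter, mem_cov] at hl ⊢
        exact ⟨⟨hl.1.1, le_top, hl.1.2.2⟩, hl.2⟩
      rw [hno R hR.1, subset_empty] at h2
      rw [h2] at h1
      unfold dd at h1
      simp only [card_empty, Nat.cast_zero] at h1
      have : (pts K X : ℤ) = q + 2 := by linarith
      exact_mod_cast this
  obtain ⟨N, hN⟩ : ∃ N, N ∉ K := by
    by_contra hcon
    push Not at hcon
    have h1 : K = univ := eq_univ_iff_forall.mpr hcon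
    have h2 := pts_univ (⊤ : Submodule F V)
    rw [← h1, pts_top, finrank_top5 hV, hk] at h2
    simp only [sum_range_succ, range_zero, sum_empty, ← hqdef, pow_zero, pow_one] at h2
    have : 2 ≤ q ^ 4 := le_trans (by omega) (Nat.le_self_pow (by norm_num) q)
    omega
  have hNP : N ≠ P := fun h => hN (h ▸ hP)
  have hne : (cov (N.submodule ⊔ P.submodule) ⊤).Nonempty := by
    rw [← card_pos, card_cov_three le_top (by rw [finrank_top5 hV, finrank_line hNP])]
    positivity
  obtain ⟨X, hX⟩ := hne
  rw [mem_cov, finrank_line hNP] at hX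
  have hNX : N.submodule ≤ X := le_sup_left.trans hX.1
  have hX3 : finrank F X = 3 := hX.2.2
  have hm : pts K X = q + 2 := by
    rcases hplane X hX3 with h | h
    · exfalso
      have : P ∈ inc K X := mem_inc.mpr ⟨hP, le_sup_right.trans hX.1⟩
      rw [card_eq_zero.mp h] at this
      simp at this
    · exact h
  obtain ⟨l, hl, hl0⟩ : ∃ l ∈ cov N.submodule X, pts K l = 0 := by
    by_contra hcon
    push Not at hcon
    have h1 := sum_cov K hNX
    rw [pts_pt_not hN, hm] at h1
    have h2 : ∀ l ∈ cov N.submodule X, (2 : ℤ) ≤ (pts K l : ℤ) - (0 : ℕ) := by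
      intro l hl
      obtain ⟨R, hR⟩ := card_pos.mp (Nat.pos_of_ne_zero (hcon l hl))
      rw [mem_inc] at hR
      have h3 : l ∉ tang K R ⊤ := by rw [hno R hR.1]; simp
      unfold tang at h3
      rw [mem_filter, mem_cov] at h3
      have hl' := mem_cov.mp hl
      have h4 : ¬ ∀ Q ∈ K, Q.submodule ≤ l → Q = R := by
        intro h5
        exact h3 ⟨⟨hR.2, le_top, by rw [hl'.2.2, N.finrank_submodule, R.finrank_submodule]⟩, h5⟩
      push Not at h4
      obtain ⟨Q, hQ, hQl, hQR⟩ := h4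
      have : 1 < pts K l := one_lt_card.mpr ⟨Q, mem_inc.mpr ⟨hQ, hQl⟩, R, mem_inc.mpr hR, hQR⟩
      push_cast; omega
    have h3 := sum_le_sum h2
    rw [h1, sum_const, card_cov_two hNX (by rw [hX3, N.finrank_submodule]), nsmul_eq_mul] at h3
    push_cast at h3
    have : (2048 : ℤ) ≤ q := by exact_mod_cast hq
    linarith
  have hl' := mem_cov.mp hl
  have hl2 : finrank F l = 2 := by rw [hl'.2.2, N.finrank_submodule]
  have h1 := sum_cov K (le_top : l ≤ ⊤)
  rw [hl0, pts_top, hkz] at h1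
  have hdvd : ((q : ℤ) + 2) ∣ ∑ W ∈ cov l ⊤, ((pts K W : ℤ) - (0 : ℕ)) := by
    apply dvd_sum
    intro W hW
    rw [mem_cov, hl2] at hW
    rcases hplane W hW.2.2 with h | h
    · rw [h]; simp
    · rw [h]; push_cast; simp
  rw [h1] at hdvd
  have h4 : ((q : ℤ) + 2) ∣ 4 := by
    have : (4 : ℤ) = (q + 2) * ((q : ℤ) ^ 2 - q + 3) - ((q : ℤ) ^ 3 + (q : ℤ) ^ 2 + q + 2 - (0 : ℕ)) := by
      push_cast; ring
    rw [this]
    exact dvd_sub (dvd_mul_right _ _) hdvd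
  have := Int.le_of_dvd (by norm_num) h4
  have : (2048 : ℤ) ≤ q := by exact_mod_cast hq
  linarith

lemma EE_sq_le (hV : finrank F V = 5) (h2 : (2 : F) = 0) (hK : CapF K)
    (hcomp : ∀ N ∉ K, ∃ P ∈ K, P ∉ tanPts K N) :
    EE K (fun X => dd K X ^ 2) ≤ (tt K - 1) * (K.card * tt K * Fintype.card F) := by
  rw [← sum_tau2 hK, ← sum_tau hV hK, mul_sum]
  apply sum_le_sum
  intro N hN
  obtain ⟨P, hP, hPt⟩ := hcomp N (mem_filter.mp hN).2
  have h := tau_le hV h2 hK (mem_filter.mp hN).2 hP hPt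
  have : (0 : ℤ) ≤ (tanPts K N).card := by positivity
  nlinarith

lemma conv_neg {c A B lo hi t : ℤ} (hc : 0 ≤ c) (h1 : c * lo ^ 2 + A * lo + B < 0)
    (h2 : c * hi ^ 2 + A * hi + B < 0) (hlo : lo ≤ t) (hhi : t ≤ hi) : c * t ^ 2 + A * t + B < 0 := by
  rcases le_or_gt (c * (t + lo) + A) 0 with h | h
  · nlinarith [mul_nonneg (sub_nonneg.mpr hlo) (neg_nonneg.mpr h)]
  · have h3 : 0 ≤ c * (hi + t) + A := by nlinarith [mul_nonneg hc (sub_nonneg.mpr (hlo.trans hhi))]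
    nlinarith [mul_nonneg (sub_nonneg.mpr hhi) h3]

/-- The basic quadratic inequality. -/
lemma quad_ineq (hV : finrank F V = 5) (h2 : (2 : F) = 0) (hK : CapF K)
    (hcomp : ∀ N ∉ K, ∃ P ∈ K, P ∉ tanPts K N) (a b : ℤ) :
    EE K (fun X => (dd K X - a) * (dd K X - b)) ≤ K.card * ((tt K - 1) * (tt K * Fintype.card F) -
      (K.card - 1) * ((a + b) * tt K - a * b * ((Fintype.card F : ℤ) ^ 2 + Fintype.card F + 1))) := by
  rw [EE_quad hV hK]
  have := EE_sq_le hV h2 hK hcomp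
  linarith

lemma quad_nonneg (hV : finrank F V = 5) (h2 : (2 : F) = 0) (hK : CapF K) {P : ℙ F V} (hP : P ∈ K)
    (hcomp : ∀ N ∉ K, ∃ P ∈ K, P ∉ tanPts K N) (a : ℤ) :
    0 ≤ (tt K - 1) * (tt K * Fintype.card F) -
      (K.card - 1) * ((a + (a + 1)) * tt K - a * (a + 1) * ((Fintype.card F : ℤ) ^ 2 + Fintype.card F + 1)) := by
  have h := quad_ineq hV h2 hK hcomp a (a + 1)
  have h0 : EE K (fun _ => 0) ≤ EE K (fun X => (dd K X - a) * (dd K X - (a + 1))) :=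
    EE_mono (fun X _ => int_prod_nonneg _ _)
  have h00 : EE K (fun _ => 0) = 0 := by unfold EE; simp
  rw [h00] at h0
  have hk : (0 : ℤ) < K.card := by exact_mod_cast card_pos.mpr ⟨P, hP⟩
  exact nonneg_of_mul_nonneg_right (h0.trans h) hk

lemma num_vals (q t k : ℤ) (hq : 2048 ≤ q) (ht0 : 0 < t) (ht : t ≤ 3 * q ^ 2 - 130 * q)
    (hk : k = q ^ 3 + q ^ 2 + q + 2 - t)
    (h : ∀ a : ℤ, 0 ≤ (t - 1) * (t * q) - (k - 1) * ((a + (a + 1)) * t - a * (a + 1) * (q ^ 2 + q + 1))) :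
    ∃ j : ℤ, (j = 1 ∨ j = 2) ∧ j * (q ^ 2 + q + 1) - 10 * q ≤ t ∧ t ≤ j * (q ^ 2 + q + 1) + 10 * q := by
  have h0 := h 0
  have h1 := h 1
  have h2 := h 2
  clear h
  subst hk
  obtain ⟨r, hr, rfl⟩ : ∃ r : ℤ, 0 ≤ r ∧ q = 2048 + r := ⟨q - 2048, by linarith, by ring⟩
  have r2 := pow_nonneg hr 2
  have r3 := pow_nonneg hr 3
  have r4 := pow_nonneg hr 4
  have r5 := pow_nonneg hr 5
  by_contra hcon
  have c1 := not_and.mp (not_and.mp (not_exists.mp hcon 1) (Or.inl rfl))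
  have c2 := not_and.mp (not_and.mp (not_exists.mp hcon 2) (Or.inr rfl))
  set q : ℤ := 2048 + r with hqd
  rcases lt_or_ge t (1 * (q ^ 2 + q + 1) - 10 * q) with hA | hA
  · have e : (t - 1) * (t * q) - (q ^ 3 + q ^ 2 + q + 2 - t - 1) * ((0 + (0 + 1)) * t - 0 * (0 + 1) * (q ^ 2 + q + 1))
      = t * ((q + 1) * t - (q ^ 3 + q ^ 2 + 2 * q + 1)) := by ring
    rw [e] at h0
    have := nonneg_of_mul_nonneg_right h0 ht0
    rw [hqd] at this hA
    nlinarith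
  have hA' := lt_of_not_ge (c1 hA)
  rcases lt_or_ge t (2 * (q ^ 2 + q + 1) - 10 * q) with hB | hB
  · have := conv_neg (c := q + 3) (A := -q - (3 * (q ^ 3 + q ^ 2 + q + 1) + 2 * (q ^ 2 + q + 1)))
      (B := (q ^ 3 + q ^ 2 + q + 1) * (2 * (q ^ 2 + q + 1))) (by linarith) ?_ ?_ hA'.le hB.le
    · nlinarith only [this, h1]
    · rw [hqd]; nlinarith only [hr, r2, r3, r4, r5]
    · rw [hqd]; nlinarith only [hr, r2, r3, r4, r5]
  have hB' := lt_of_not_ge (c2 hB)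
  have := conv_neg (c := q + 5) (A := -q - (5 * (q ^ 3 + q ^ 2 + q + 1) + 6 * (q ^ 2 + q + 1)))
      (B := (q ^ 3 + q ^ 2 + q + 1) * (6 * (q ^ 2 + q + 1))) (by linarith) ?_ ?_ hB'.le ht
  · nlinarith only [this, h2]
  · rw [hqd]; nlinarith only [hr, r2, r3, r4, r5]
  · rw [hqd]; nlinarith only [hr, r2, r3, r4, r5]

lemma num_V (q t k j : ℤ) (hq : 2048 ≤ q) (hj : j = 1 ∨ j = 2)
    (h1 : j * (q ^ 2 + q + 1) - 10 * q ≤ t) (h2 : t ≤ j * (q ^ 2 + q + 1) + 10 * q)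
    (hk : k = q ^ 3 + q ^ 2 + q + 2 - t) :
    (t - 1) * (t * q) - (k - 1) * ((j + j) * t - j * j * (q ^ 2 + q + 1)) ≤ 9 * q * (k - 1) := by
  subst hk
  obtain ⟨r, hr, hqd⟩ : ∃ r : ℤ, 0 ≤ r ∧ q = 2048 + r := ⟨q - 2048, by linarith, by ring⟩
  have r2 := pow_nonneg hr 2
  have r3 := pow_nonneg hr 3
  have r4 := pow_nonneg hr 4
  have r5 := pow_nonneg hr 5
  rcases hj with rfl | rfl
  · have := conv_neg (c := q + 2) (A := -q - (2 * (q ^ 3 + q ^ 2 + q + 1) + (q ^ 2 + q + 1)) + 9 * q)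
      (B := (q ^ 3 + q ^ 2 + q + 1) * (q ^ 2 + q + 1) - 9 * q * (q ^ 3 + q ^ 2 + q + 1)) (by linarith) ?_ ?_ h1 h2
    · nlinarith only [this]
    · rw [hqd]; nlinarith only [hr, r2, r3, r4, r5]
    · rw [hqd]; nlinarith only [hr, r2, r3, r4, r5]
  · have := conv_neg (c := q + 4) (A := -q - (4 * (q ^ 3 + q ^ 2 + q + 1) + 4 * (q ^ 2 + q + 1)) + 9 * q)
      (B := (q ^ 3 + q ^ 2 + q + 1) * (4 * (q ^ 2 + q + 1)) - 9 * q * (q ^ 3 + q ^ 2 + q + 1)) (by linarith) ?_ ?_ h1 h2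
    · nlinarith only [this]
    · rw [hqd]; nlinarith only [hr, r2, r3, r4, r5]
    · rw [hqd]; nlinarith only [hr, r2, r3, r4, r5]

/-- Final contradiction. -/
lemma num_final (q t k j V n : ℤ) (hq : 2048 ≤ q) (hj : j = 1 ∨ j = 2)
    (h1 : j * (q ^ 2 + q + 1) - 10 * q ≤ t) (h2 : t ≤ j * (q ^ 2 + q + 1) + 10 * q)
    (hk : k = q ^ 3 + q ^ 2 + q + 2 - t) (hV : V ≤ k * (9 * q * (k - 1)))
    (hn : (q ^ 2 - 2 * q) * (k * (k - 1) * (q ^ 2 + q + 1) - 18 * V) ≤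
      t ^ 2 * ((q ^ 2 - 2 * q) * n + (t * (q ^ 4 + q ^ 3 + q ^ 2 + q + 1 - k) - k * t * q)))
    (hn2 : 11 * ((q - 10) * (q - 11) * q ^ 2 * n) ≤ 180 * V) : False := by
  have hjv : 1 ≤ j ∧ j ≤ 2 := by omega
  have hv : 0 < q ^ 2 + q + 1 := by positivity
  have ht1 : q ^ 2 - 9 * q + 1 ≤ t := by nlinarith
  have ht2 : t ≤ 2 * q ^ 2 + 12 * q + 2 := by nlinarith
  have hk1 : k ≤ q ^ 3 + 10 * q + 1 := by linarith
  have hk2 : q ^ 3 - q ^ 2 - 11 * q ≤ k := by linarith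
  have ht0 : 0 ≤ t := by nlinarith
  obtain ⟨r, hr, hqd⟩ : ∃ r : ℤ, 0 ≤ r ∧ q = 2048 + r := ⟨q - 2048, by linarith, by ring⟩
  have r2 := pow_nonneg hr 2
  have r3 := pow_nonneg hr 3
  have r4 := pow_nonneg hr 4
  have r5 := pow_nonneg hr 5
  have r6 := pow_nonneg hr 6
  have r7 := pow_nonneg hr 7
  have r8 := pow_nonneg hr 8
  have r9 := pow_nonneg hr 9
  have r10 := pow_nonneg hr 10
  have hk0 : 1 ≤ q ^ 3 - q ^ 2 - 11 * q := by rw [hqd]; nlinarith only [hr, r2, r3]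
  have hkk : k * (k - 1) ≤ (q ^ 3 + 10 * q + 1) * (q ^ 3 + 10 * q + 1) := by
    apply mul_le_mul hk1 (by linarith) (by linarith) (by linarith)
  have hkk2 : (q ^ 3 - q ^ 2 - 11 * q) * (q ^ 3 - q ^ 2 - 11 * q - 1) ≤ k * (k - 1) := by
    apply mul_le_mul hk2 (by linarith) (by linarith) (by linarith)
  have hnq : n < 152 * q ^ 3 := by
    by_contra hcon
    rw [not_lt] at hcon
    have hc : 0 ≤ (q - 10) * (q - 11) * q ^ 2 := by
      apply mul_nonneg (mul_nonneg _ _) (by positivity) <;> linarith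
    have a1 := mul_le_mul_of_nonneg_left hcon hc
    have a2 : V ≤ 9 * q * ((q ^ 3 + 10 * q + 1) * (q ^ 3 + 10 * q + 1)) := by
      have := mul_le_mul_of_nonneg_left hkk (by linarith : 0 ≤ 9 * q)
      linarith
    have a3 : 11 * ((q - 10) * (q - 11) * q ^ 2 * (152 * q ^ 3)) ≤
      180 * (9 * q * ((q ^ 3 + 10 * q + 1) * (q ^ 3 + 10 * q + 1))) := by linarith
    rw [hqd] at a3
    nlinarith only [a3, hr, r2, r3, r4, r5, r6, r7]
  -- main inequality
  have hq2 : 0 ≤ q ^ 2 - 2 * q := by nlinarith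
  have b1 : k * (k - 1) * (q ^ 2 - 161 * q) ≤ k * (k - 1) * (q ^ 2 + q + 1) - 18 * V := by
    have : 0 ≤ k * (k - 1) := mul_nonneg (by linarith) (by linarith)
    linarith
  have b2 : (q ^ 3 - q ^ 2 - 11 * q) * (q ^ 3 - q ^ 2 - 11 * q - 1) * (q ^ 2 - 161 * q) ≤
      k * (k - 1) * (q ^ 2 - 161 * q) := mul_le_mul_of_nonneg_right hkk2 (by nlinarith)
  have b3 := mul_le_mul_of_nonneg_left (b2.trans b1) hq2
  have D1 : q ^ 4 + q ^ 3 + q ^ 2 + q + 1 - k - k * q ≤ 2 * q ^ 3 := by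
    have := mul_le_mul_of_nonneg_right hk2 (by linarith : 0 ≤ q + 1)
    rw [hqd] at this ⊢
    nlinarith only [this, hr, r2, r3]
  have b4 : t * (q ^ 4 + q ^ 3 + q ^ 2 + q + 1 - k) - k * t * q ≤ (2 * q ^ 2 + 12 * q + 2) * (2 * q ^ 3) := by
    have s1 := mul_le_mul_of_nonneg_left D1 ht0
    have s2 := mul_le_mul_of_nonneg_right ht2 (by positivity : 0 ≤ 2 * q ^ 3)
    linarith
  have b5 : (q ^ 2 - 2 * q) * n ≤ (q ^ 2 - 2 * q) * (152 * q ^ 3) := mul_le_mul_of_nonneg_left hnq.le hq2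
  have b6 : t ^ 2 ≤ (2 * q ^ 2 + 12 * q + 2) ^ 2 := pow_le_pow_left₀ ht0 ht2 2
  have b7 : 0 ≤ (q ^ 2 - 2 * q) * (152 * q ^ 3) + (2 * q ^ 2 + 12 * q + 2) * (2 * q ^ 3) := by positivity
  have b8 := mul_le_mul_of_nonneg_left (add_le_add b5 b4) (sq_nonneg t)
  have b9 := mul_le_mul_of_nonneg_right b6 b7
  have b10 := b3.trans (hn.trans (b8.trans b9))
  rw [hqd] at b10
  nlinarith only [b10, hr, r2, r3, r4, r5, r6, r7, r8, r9, r10]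

end vals
end CapAux

namespace CapAux

/-! ### Part 7: good planes and conclusion -/

section fin
set_option linter.unusedSectionVars false
open Classical Finset
open scoped LinearAlgebra.Projectivization

variable {F : Type*} [Field F] [Fintype F] {V : Type*} [AddCommGroup V] [Module F V]
  [FiniteDimensional F V] [Fintype (ℙ F V)] [Fintype (Submodule F V)]
variable {K : Finset (ℙ F V)}

/-- The solid has about `j (q+1)` tangents at a point. -/
def Typ (K : Finset (ℙ F V)) (j : ℤ) (S : Submodule F V) : Prop :=
  4 * |ts K S - j * (Fintype.card F + 1)| ≤ Fintype.card F

/-- The plane has defect `j` and lies in typical solids only. -/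
def Good (K : Finset (ℙ F V)) (j : ℤ) (X : Submodule F V) : Prop :=
  dd K X = j ∧ ∀ S ∈ cov X ⊤, Typ K j S

lemma num_atyp (q s D : ℤ) (hq : 2048 ≤ q) (hD : |D| ≤ 10 * q) (hs : q < 4 * |s|) :
    q ^ 2 * (q - 40) ^ 2 ≤ 16 * (q * s - D) ^ 2 := by
  have h1 : q * (q - 40) ≤ 4 * |q * s - D| := by
    have := abs_sub_abs_le_abs_sub (q * s) D
    rw [abs_mul, abs_of_nonneg (by linarith : (0 : ℤ) ≤ q)] at this
    nlinarith
  have h2 : 0 ≤ q * (q - 40) := mul_nonneg (by linarith) (by linarith)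
  have h3 := pow_le_pow_left₀ h2 h1 2
  rw [mul_pow, mul_pow, sq_abs] at h3
  linarith

lemma nongood_count (hV : finrank F V = 5) (hK : CapF K) (hq : 2048 ≤ Fintype.card F) {j : ℤ}
    (hD : |tt K - j * ((Fintype.card F : ℤ) ^ 2 + Fintype.card F + 1)| ≤ 10 * (Fintype.card F : ℤ))
    {P Q : ℙ F V} (hP : P ∈ K) (hQ : Q ∈ K) (hne : P ≠ Q) :
    ((((cov (P.submodule ⊔ Q.submodule) ⊤).filter (fun X => ¬ Good K j X)).card : ℕ) : ℤ) ≤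
      18 * ∑ X ∈ cov (P.submodule ⊔ Q.submodule) ⊤, (dd K X - j) * (dd K X - j) := by
  set L := P.submodule ⊔ Q.submodule with hL
  set q : ℤ := (Fintype.card F : ℤ) with hqd
  have hq' : (2048 : ℤ) ≤ q := by rw [hqd]; exact_mod_cast hq
  have hL2 : finrank F L = 2 := finrank_line hne
  have h53 : finrank F (⊤ : Submodule F V) = finrank F L + 3 := by rw [finrank_top5 hV, hL2]
  set w : Submodule F V → ℤ := fun X => dd K X - j with hw
  set D : ℤ := tt K - j * (q ^ 2 + q + 1) with hDd
  set W : ℤ := ∑ X ∈ cov L ⊤, (dd K X - j) * (dd K X - j) with hW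
  have hW' : ∑ X ∈ cov L ⊤, w X ^ 2 = W := by
    rw [hW]; apply sum_congr rfl; intro X _; rw [hw]; ring
  have hsum : ∑ X ∈ cov L ⊤, w X = D := by
    rw [hw, sum_sub_distrib, sum_dd_top hV hK hP hQ hne, sum_const, card_cov_three le_top h53, hDd, hqd,
      nsmul_eq_mul]
    push_cast; ring
  have hS : ∀ S ∈ cov2 L ⊤, ∑ X ∈ cov L S, w X = ts K S - j * (q + 1) := by
    intro S hS
    rw [mem_cov2, hL2] at hS
    rw [hw, sum_sub_distrib, sum_dd_solid hK hP hQ hne hS.1 hS.2.2, sum_const,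
      card_cov_two hS.1 (by rw [hS.2.2, hL2]), nsmul_eq_mul]
    push_cast; ring
  have e1 := sum_cov2 h53 w
  have e2 := sum_sq_cov2 h53 w
  have e3 := card_cov2 (le_top : L ≤ ⊤) h53
  rw [hsum] at e1 e2
  rw [hW'] at e2
  have e3' : ((cov2 L ⊤).card : ℤ) = q ^ 2 + q + 1 := by rw [e3]; push_cast; rfl
  have hvar : ∑ S ∈ cov2 L ⊤, (q * (∑ X ∈ cov L S, w X) - D) ^ 2 = q ^ 3 * W + (1 - q) * D ^ 2 := by
    have : ∀ S ∈ cov2 L ⊤, (q * (∑ X ∈ cov L S, w X) - D) ^ 2 =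
      q ^ 2 * (∑ X ∈ cov L S, w X) ^ 2 - 2 * q * D * (∑ X ∈ cov L S, w X) + D ^ 2 := by intro S _; ring
    rw [sum_congr rfl this, sum_add_distrib, sum_sub_distrib, ← mul_sum, ← mul_sum, e1, e2, sum_const,
      nsmul_eq_mul, e3']
    ring
  set At := (cov2 L ⊤).filter (fun S => ¬ Typ K j S) with hAt
  have hAtc : (At.card : ℤ) * (q ^ 2 * (q - 40) ^ 2) ≤ 16 * (q ^ 3 * W) := by
    have s1 : ∑ S ∈ At, q ^ 2 * (q - 40) ^ 2 ≤ ∑ S ∈ At, 16 * (q * (∑ X ∈ cov L S, w X) - D) ^ 2 := by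
      apply sum_le_sum
      intro S hSA
      rw [hAt, mem_filter] at hSA
      rw [hS S hSA.1]
      apply num_atyp _ _ _ hq' hD
      have := hSA.2
      unfold Typ at this
      exact lt_of_not_ge this
    have s2 : ∑ S ∈ At, 16 * (q * (∑ X ∈ cov L S, w X) - D) ^ 2 ≤
        ∑ S ∈ cov2 L ⊤, 16 * (q * (∑ X ∈ cov L S, w X) - D) ^ 2 :=
      sum_le_sum_of_subset_of_nonneg (filter_subset _ _) (fun _ _ _ => by positivity)
    rw [← mul_sum, ← mul_sum, hvar] at s2
    rw [sum_const, nsmul_eq_mul, ← mul_sum] at s1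
    have : (1 - q) * D ^ 2 ≤ 0 := mul_nonpos_of_nonpos_of_nonneg (by linarith) (sq_nonneg _)
    linarith
  have hW0 : 0 ≤ W := sum_nonneg (fun _ _ => mul_self_nonneg _)
  have hA17 : (q + 1) * At.card ≤ 17 * W := by
    have hpos : 0 < q ^ 2 * (q - 40) ^ 2 := by
      have : 0 < q - 40 := by linarith
      positivity
    have hnum : 16 * q * (q + 1) ≤ 17 * (q - 40) ^ 2 := by nlinarith
    have a1 := mul_le_mul_of_nonneg_right hAtc (by linarith : 0 ≤ q + 1)
    have a2 := mul_le_mul_of_nonneg_right hnum (mul_nonneg (sq_nonneg q) hW0)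
    refine le_of_mul_le_mul_right ?_ hpos
    nlinarith only [a1, a2]
  have hsub : (cov L ⊤).filter (fun X => ¬ Good K j X) ⊆
      (cov L ⊤).filter (fun X => dd K X ≠ j) ∪ At.biUnion (fun S => cov L S) := by
    intro X hX
    rw [mem_filter] at hX
    rw [mem_union, mem_filter, mem_biUnion]
    by_cases hd : dd K X = j
    · right
      have h := hX.2
      unfold Good at h
      push Not at h
      obtain ⟨S, hSX, hST⟩ := h hd
      have hX1 := mem_cov.mp hX.1
      rw [mem_cov] at hSX
      refine ⟨S, ?_, mem_cov.mpr ⟨hX1.1, hSX.1, hX1.2.2⟩⟩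
      rw [hAt, mem_filter, mem_cov2]
      exact ⟨⟨hX1.1.trans hSX.1, le_top, by rw [hSX.2.2, hX1.2.2]⟩, hST⟩
    · exact Or.inl ⟨hX.1, hd⟩
  have c1 := (card_le_card hsub).trans (card_union_le _ _)
  have c2 : (((cov L ⊤).filter (fun X => dd K X ≠ j)).card : ℤ) ≤ W := by
    have : ∑ X ∈ (cov L ⊤).filter (fun X => dd K X ≠ j), (1 : ℤ) ≤
        ∑ X ∈ (cov L ⊤).filter (fun X => dd K X ≠ j), (dd K X - j) * (dd K X - j) := by
      apply sum_le_sum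
      intro X hX
      have h := (mem_filter.mp hX).2
      have : 0 < (dd K X - j) * (dd K X - j) := mul_self_pos.mpr (sub_ne_zero.mpr h)
      omega
    rw [sum_const, nsmul_eq_mul, mul_one] at this
    exact this.trans (sum_le_sum_of_subset_of_nonneg (filter_subset _ _) (fun _ _ _ => mul_self_nonneg _))
  have c3 : ((At.biUnion (fun S => cov L S)).card : ℤ) ≤ (q + 1) * At.card := by
    have : (At.biUnion (fun S => cov L S)).card ≤ At.card * (Fintype.card F + 1) := by
      apply card_biUnion_le_card_mul
      intro S hSA
      rw [hAt, mem_filter, mem_cov2] at hSA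
      rw [card_cov_two hSA.1.1 hSA.1.2.2]
    have h := (Int.ofNat_le.mpr this)
    push_cast at h
    linarith
  have c4 : ((((cov L ⊤).filter (fun X => ¬ Good K j X)).card : ℕ) : ℤ) ≤
    ((cov L ⊤).filter (fun X => dd K X ≠ j)).card + (At.biUnion (fun S => cov L S)).card := by
    exact_mod_cast c1
  linarith

lemma good_EE (hV : finrank F V = 5) (hK : CapF K) (hq : 2048 ≤ Fintype.card F) {j : ℤ}
    (hD : |tt K - j * ((Fintype.card F : ℤ) ^ 2 + Fintype.card F + 1)| ≤ 10 * (Fintype.card F : ℤ)) :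
    K.card * (K.card - 1) * ((Fintype.card F : ℤ) ^ 2 + Fintype.card F + 1) -
      18 * EE K (fun X => (dd K X - j) * (dd K X - j)) ≤ EE K (fun X => if Good K j X then 1 else 0) := by
  rw [← EE_one hV, ← EE_eq, ← EE_eq, ← EE_eq, mul_sum, ← sum_sub_distrib]
  apply sum_le_sum
  rintro ⟨P, Q⟩ hz
  rw [mem_offDiag] at hz
  have h := nongood_count hV hK hq hD hz.1 hz.2.1 hz.2.2
  have h2 : ∑ X ∈ cov (P.submodule ⊔ Q.submodule) ⊤, (1 : ℤ) =
      (∑ X ∈ cov (P.submodule ⊔ Q.submodule) ⊤, if Good K j X then (1 : ℤ) else 0) +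
      (((cov (P.submodule ⊔ Q.submodule) ⊤).filter (fun X => ¬ Good K j X)).card : ℤ) := by
    rw [← sum_boole, ← sum_add_distrib]
    apply sum_congr rfl
    intro X _
    by_cases hg : Good K j X <;> simp [hg]
  rw [h2]
  linarith

lemma solid_of_good (hV : finrank F V = 5) (h2 : (2 : F) = 0) (hK : CapF K) {j : ℤ}
    (hj : j = 1 ∨ j = 2) {X : Submodule F V} (hX : finrank F X = 3) (hd : dd K X = j)
    {N : ℙ F V} (hN : N ∉ K) (hNX : N.submodule ≤ X) (hnuc : inc K X ⊆ tanPts K N)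
    (hτ : tt K - (Fintype.card F : ℤ) ^ 2 + 2 * Fintype.card F < (tanPts K N).card) :
    ∃ S ∈ cov X ⊤, inc K S ⊆ tanPts K N := by
  by_contra hcon
  push Not at hcon
  have ha : pts (tanPts K N) X = pts K X := by
    apply le_antisymm (pts_le_of_subset (tanPts_subset N) X)
    apply card_le_card
    intro P hP
    exact mem_inc.mpr ⟨hnuc hP, (mem_inc.mp hP).2⟩
  have h1 := sum_cov (tanPts K N) (le_top : X ≤ ⊤)
  have h3 := sum_cov K (le_top : X ≤ ⊤)
  rw [ha, pts_top] at h1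
  rw [pts_top] at h3
  have hc : (cov X ⊤).card = Fintype.card F + 1 := card_cov_two le_top (by rw [finrank_top5 hV, hX])
  have h4 : ∀ S ∈ cov X ⊤, ((pts (tanPts K N) S : ℤ) - pts K X) + ((pts K S : ℤ) - pts K X) ≤
      (Fintype.card F : ℤ) ^ 2 + Fintype.card F + 2 - 2 * pts K X := by
    intro S hS
    obtain ⟨Q, hQ, hQt⟩ := not_subset.mp (hcon S hS)
    rw [mem_inc] at hQ
    rw [mem_cov, hX] at hS
    have := solid_le h2 hK hN hS.2.2 (hNX.trans hS.1) hQ.1 hQ.2 hQt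
    unfold ts at this
    linarith
  have h5 := sum_le_sum h4
  rw [sum_add_distrib, h1, h3, sum_const, hc, nsmul_eq_mul] at h5
  have hm : (pts K X : ℤ) = Fintype.card F + 2 - j := by rw [← hd]; unfold dd; ring
  rw [hm] at h5
  unfold tt at hτ
  push_cast at h5
  have : (0 : ℤ) ≤ Fintype.card F := by positivity
  rcases hj with rfl | rfl <;> nlinarith

/-- The special points. -/
noncomputable def NN (K : Finset (ℙ F V)) (j : ℤ) : Finset (ℙ F V) :=
  (univ.filter (fun N => N ∉ K)).filter (fun N => ∃ S : Submodule F V, finrank F S = 4 ∧ N.submodule ≤ S ∧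
    inc K S ⊆ tanPts K N ∧ Typ K j S)

lemma NN_lower (hV : finrank F V = 5) (h2 : (2 : F) = 0) (hK : CapF K) (hq : 2048 ≤ Fintype.card F)
    (hcomp : ∀ N ∉ K, ∃ P ∈ K, P ∉ tanPts K N) {j : ℤ} (hj : j = 1 ∨ j = 2) :
    ((Fintype.card F : ℤ) ^ 2 - 2 * Fintype.card F) * EE K (fun X => if Good K j X then 1 else 0) ≤
    tt K ^ 2 * (((Fintype.card F : ℤ) ^ 2 - 2 * Fintype.card F) * (NN K j).card +
      (tt K * ((Fintype.card F : ℤ) ^ 4 + (Fintype.card F : ℤ) ^ 3 + (Fintype.card F : ℤ) ^ 2 + Fintype.card F + 1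
        - K.card) - K.card * tt K * Fintype.card F)) := by
  set q : ℤ := (Fintype.card F : ℤ) with hqd
  have hq' : (2048 : ℤ) ≤ q := by rw [hqd]; exact_mod_cast hq
  have hq2 : 0 ≤ q ^ 2 - 2 * q := by nlinarith
  set G : ℙ F V → ℤ := fun N => ∑ X ∈ (planes F V).filter (fun X => N.submodule ≤ X),
    if (Good K j X ∧ inc K X ⊆ tanPts K N) then (pts K X : ℤ) * (pts K X - 1) else 0 with hG
  have hswap : EE K (fun X => if Good K j X then 1 else 0) ≤ ∑ N ∈ univ.filter (fun N => N ∉ K), G N := by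
    have e : ∀ N, G N = ∑ X ∈ planes F V, if N.submodule ≤ X then
        (if (Good K j X ∧ inc K X ⊆ tanPts K N) then (pts K X : ℤ) * (pts K X - 1) else 0) else 0 := by
      intro N; rw [hG]; simp only [sum_filter]
    rw [sum_congr rfl (fun N _ => e N), sum_comm]
    unfold EE
    apply sum_le_sum
    intro X hX
    have hnn : ∀ N ∈ univ.filter (fun N => N ∉ K), (0 : ℤ) ≤ if N.submodule ≤ X then
        (if (Good K j X ∧ inc K X ⊆ tanPts K N) then (pts K X : ℤ) * (pts K X - 1) else 0) else 0 := by
      intro N _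
      have := mm_nonneg (pts K X)
      split_ifs <;> first | exact this | exact le_refl _
    beta_reduce
    by_cases hg : Good K j X
    · obtain ⟨N, hN, hNX, hnuc⟩ := nucleus h2 hK hq (mem_planes.mp hX) (by rw [hg.1]; exact hj)
      have := single_le_sum hnn (mem_filter.mpr ⟨mem_univ N, hN⟩)
      rw [if_pos hNX, if_pos ⟨hg, hnuc⟩] at this
      rw [if_pos hg, mul_one]
      exact this
    · rw [if_neg hg, mul_zero]
      exact sum_nonneg hnn
  have hper : ∀ N ∈ univ.filter (fun N => N ∉ K), (q ^ 2 - 2 * q) * G N ≤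
      tt K ^ 2 * ((q ^ 2 - 2 * q) * (if (∃ S : Submodule F V, finrank F S = 4 ∧ N.submodule ≤ S ∧
        inc K S ⊆ tanPts K N ∧ Typ K j S) then 1 else 0) + (tt K - (tanPts K N).card)) := by
    intro N hN
    have hN := (mem_filter.mp hN).2
    obtain ⟨P, hP, hPt⟩ := hcomp N hN
    have hτ := tau_le hV h2 hK hN hP hPt
    have hτ0 : (0 : ℤ) ≤ (tanPts K N).card := by positivity
    have hGt : G N ≤ tt K ^ 2 := by
      have : G N ≤ ((tanPts K N).card : ℤ) * ((tanPts K N).card - 1) := by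
        rw [tau_planes hN, hG]
        apply sum_le_sum
        intro X _
        split_ifs with h
        · have ha : pts (tanPts K N) X = pts K X := by
            apply le_antisymm (pts_le_of_subset (tanPts_subset N) X)
            apply card_le_card
            intro P hP
            exact mem_inc.mpr ⟨h.2 hP, (mem_inc.mp hP).2⟩
          rw [ha]
        · exact mm_nonneg _
      nlinarith
    by_cases hS : ∃ S : Submodule F V, finrank F S = 4 ∧ N.submodule ≤ S ∧
        inc K S ⊆ tanPts K N ∧ Typ K j S
    · rw [if_pos hS]
      have s1 := mul_le_mul_of_nonneg_left hGt hq2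
      have s2 := mul_nonneg (sq_nonneg (tt K)) (sub_nonneg.mpr hτ)
      linarith
    · rw [if_neg hS]
      by_cases hX : ∃ X ∈ (planes F V).filter (fun X => N.submodule ≤ X), Good K j X ∧ inc K X ⊆ tanPts K N
      · obtain ⟨X, hX, hg, hnuc⟩ := hX
        rw [mem_filter, mem_planes] at hX
        have hle : q ^ 2 - 2 * q ≤ tt K - (tanPts K N).card := by
          by_contra hlt
          obtain ⟨S, hSX, hSn⟩ := solid_of_good hV h2 hK hj hX.1 hg.1 hN hX.2 hnuc (by rw [← hqd]; linarith)
          have hSX' := mem_cov.mp hSX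
          exact hS ⟨S, by rw [hSX'.2.2, hX.1], hX.2.trans hSX'.1, hSn, hg.2 S hSX⟩
        have s1 := mul_le_mul_of_nonneg_left hGt hq2
        have s2 := mul_le_mul_of_nonneg_left hle (sq_nonneg (tt K))
        linarith
      · have hG0 : G N = 0 := by
          rw [hG]
          apply sum_eq_zero
          intro X hX'
          rw [if_neg]
          intro h
          exact hX ⟨X, hX', h⟩
        rw [hG0]
        have s2 := mul_nonneg (sq_nonneg (tt K)) (sub_nonneg.mpr hτ)
        linarith
  have hcard : ((univ.filter (fun N => N ∉ K)).card : ℤ) = q ^ 4 + q ^ 3 + q ^ 2 + q + 1 - K.card := by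
    have s1 := pts_univ (⊤ : Submodule F V)
    rw [pts_top, finrank_top5 hV] at s1
    have s2 : (univ.filter (fun N => N ∉ K)).card + K.card = (univ : Finset (ℙ F V)).card := by
      have : univ.filter (fun N => N ∉ K) = Kᶜ := by ext; simp
      rw [this, card_compl, card_univ]
      exact Nat.sub_add_cancel (card_le_univ K)
    rw [s1] at s2
    simp only [sum_range_succ, range_zero, sum_empty, pow_zero, pow_one] at s2
    have s3 := congrArg (fun n : ℕ => (n : ℤ)) s2
    push_cast at s3
    linarith
  have s := sum_le_sum hper
  rw [← mul_sum, ← mul_sum, sum_add_distrib, ← mul_sum, sum_boole, sum_sub_distrib, sum_tau hV hK, sum_const,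
    nsmul_eq_mul, hcard] at s
  have s2 := mul_le_mul_of_nonneg_left hswap hq2
  refine (s2.trans s).trans (le_of_eq ?_)
  unfold NN
  ring

lemma num_local (q j T c : ℤ) (hq : 2048 ≤ q) (hj : j = 1 ∨ j = 2) (hT : T = q ^ 2 + q + 2 - c)
    (h : 4 * |T - j * (q + 1)| ≤ q) :
    11 * q ^ 2 ≤ 2 * (-((q + 2) ^ 2 * (q ^ 2 + q + 1) - 2 * (q + 2) * ((q + 1) * c) + (q * c + c ^ 2))
      + (13 + j) * ((q + 2) * (q ^ 2 + q + 1) - (q + 1) * c) - 13 * j * (q ^ 2 + q + 1)) := by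
  have h1 := abs_le.mp (le_refl |T - j * (q + 1)|)
  have hc : c = q ^ 2 + q + 2 - T := by linarith
  subst hc
  have hlo : 4 * (j * (q + 1)) - q ≤ 4 * T := by linarith [h1.1]
  have hhi : 4 * T ≤ 4 * (j * (q + 1)) + q := by linarith [h1.2]
  rcases hj with rfl | rfl
  · have := conv_neg (c := 1) (A := 4 * q - 8 - 48 * (q + 1))
      (B := 16 - 16 * q + 192 * (q + 1) + 88 * q ^ 2) (by norm_num) (by nlinarith) (by nlinarith) hlo hhi
    nlinarith only [this]
  · have := conv_neg (c := 1) (A := 4 * q - 8 - 52 * (q + 1))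
      (B := 16 - 16 * q + 208 * (q + 1) + 192 * (q ^ 2 + q + 1) + 88 * q ^ 2) (by norm_num) (by nlinarith) (by nlinarith) hlo hhi
    nlinarith only [this]

lemma local_sum (hK : CapF K) (hq : 2048 ≤ Fintype.card F) {j : ℤ} (hj : j = 1 ∨ j = 2)
    {N : ℙ F V} (hN : N ∉ K) {S : Submodule F V} (hS : finrank F S = 4) (hNS : N.submodule ≤ S)
    (hSn : inc K S ⊆ tanPts K N) (hT : Typ K j S) :
    11 * (Fintype.card F : ℤ) ^ 2 ≤ 2 * ∑ X ∈ cov2 N.submodule S, (dd K X - j) * (13 - dd K X) := by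
  set q : ℤ := (Fintype.card F : ℤ) with hqd
  have hq' : (2048 : ℤ) ≤ q := by rw [hqd]; exact_mod_cast hq
  have h43 : finrank F S = finrank F N.submodule + 3 := by rw [hS, N.finrank_submodule]
  have hm : ∀ X : Submodule F V, N.submodule ≤ X → ∑ l ∈ cov N.submodule X, (pts K l : ℤ) = pts K X := by
    intro X hX
    have := sum_cov K hX
    rw [pts_pt_not hN] at this
    simpa using this
  have hw : ∀ l ∈ cov N.submodule S, (pts K l : ℤ) ^ 2 = pts K l := by
    intro l hl
    have hl' := mem_cov.mp hl
    have : pts K l ≤ 1 := by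
      apply card_le_one.mpr
      intro P hP Q hQ
      rw [mem_inc] at hP hQ
      have hPt := mem_tanPts.mp (hSn (mem_inc.mpr ⟨hP.1, hP.2.trans hl'.2.1⟩))
      have hPN : N ≠ P := fun h => hN (h ▸ hP.1)
      have : N.submodule ⊔ P.submodule = l :=
        sup_eq_cov hl hP.2 (fun h => hPN (pt_le_pt h).symm)
      exact (hPt.2 Q hQ.1 (this ▸ hQ.2)).symm
    interval_cases (pts K l) <;> simp
  have e1 := sum_cov2 h43 (fun l => (pts K l : ℤ))
  have e2 := sum_sq_cov2 h43 (fun l => (pts K l : ℤ))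
  have e3 := card_cov2 hNS h43
  have e3' : ((cov2 N.submodule S).card : ℤ) = q ^ 2 + q + 1 := by rw [e3]; push_cast; rfl
  rw [sum_congr rfl (fun X hX => hm X (mem_cov2.mp hX).1), hm S hNS] at e1
  rw [sum_congr rfl (fun X hX => by rw [hm X (mem_cov2.mp hX).1]), sum_congr rfl hw, hm S hNS] at e2
  have e : ∀ X ∈ cov2 N.submodule S, (dd K X - j) * (13 - dd K X) =
      (-(q + 2) ^ 2 + (13 + j) * (q + 2) - 13 * j) + ((2 * (q + 2) - (13 + j)) * (pts K X : ℤ) - (pts K X : ℤ) ^ 2) := by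
    intro X _; unfold dd; rw [← hqd]; ring
  rw [sum_congr rfl e, sum_add_distrib, sum_const, sum_sub_distrib, ← mul_sum, e1, e2, nsmul_eq_mul, e3']
  have := num_local q j (ts K S) (pts K S) hq' hj rfl hT
  linarith

/-- The weight. -/
noncomputable def gg (K : Finset (ℙ F V)) (j : ℤ) (X : Submodule F V) : ℤ :=
  max 0 ((dd K X - j) * (13 - dd K X))

lemma gg_le (j d : ℤ) (hj : j = 1 ∨ j = 2) (hd : 0 ≤ d) :
    d ^ 2 * max 0 ((d - j) * (13 - d)) ≤ 90 * ((d - j) * (d - j)) := by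
  rcases le_or_gt ((d - j) * (13 - d)) 0 with h | h
  · rw [max_eq_left h]
    nlinarith [mul_self_nonneg (d - j)]
  · rw [max_eq_right h.le]
    have h1 : d < 13 := by
      by_contra hc
      rcases hj with rfl | rfl <;> nlinarith
    rcases hj with rfl | rfl <;> interval_cases d <;> norm_num

lemma NN_upper (hK : CapF K) (hq : 2048 ≤ Fintype.card F) {j : ℤ} (hj : j = 1 ∨ j = 2) :
    11 * (((Fintype.card F : ℤ) - 10) * (Fintype.card F - 11) * (Fintype.card F : ℤ) ^ 2 * (NN K j).card) ≤
      180 * EE K (fun X => (dd K X - j) * (dd K X - j)) := by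
  set q : ℤ := (Fintype.card F : ℤ) with hqd
  have hq' : (2048 : ℤ) ≤ q := by rw [hqd]; exact_mod_cast hq
  have hqq : 0 ≤ (q - 10) * (q - 11) := mul_nonneg (by linarith) (by linarith)
  have hgg0 : ∀ X, 0 ≤ gg K j X := fun X => le_max_left _ _
  set H : ℙ F V → ℤ := fun N => ∑ X ∈ (planes F V).filter (fun X => N.submodule ≤ X),
      (pts (tanPts K N) X : ℤ) * (pts (tanPts K N) X - 1) * gg K j X with hH
  have hH0 : ∀ N, 0 ≤ H N := fun N => sum_nonneg (fun X _ => mul_nonneg (mm_nonneg _) (hgg0 X))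
  have hper : ∀ N ∈ NN K j, 11 * ((q - 10) * (q - 11) * q ^ 2) ≤ 2 * H N := by
    intro N hN
    unfold NN at hN
    rw [mem_filter, mem_filter] at hN
    obtain ⟨⟨_, hN⟩, S, hS, hNS, hSn, hT⟩ := hN
    have h1 := local_sum hK hq hj hN hS hNS hSn hT
    rw [← hqd] at h1
    have h2 : ∑ X ∈ cov2 N.submodule S, (q - 10) * (q - 11) * ((dd K X - j) * (13 - dd K X)) ≤ H N := by
      have hsub : cov2 N.submodule S ⊆ (planes F V).filter (fun X => N.submodule ≤ X) := by
        intro X hX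
        rw [mem_cov2, N.finrank_submodule] at hX
        exact mem_filter.mpr ⟨mem_planes.mpr hX.2.2, hX.1⟩
      refine le_trans ?_ (sum_le_sum_of_subset_of_nonneg hsub
        (fun X _ _ => mul_nonneg (mm_nonneg _) (hgg0 X)))
      apply sum_le_sum
      intro X hX
      rw [mem_cov2, N.finrank_submodule] at hX
      rcases le_or_gt ((dd K X - j) * (13 - dd K X)) 0 with h | h
      · have a1 := mul_nonneg (mm_nonneg (pts (tanPts K N) X)) (hgg0 X)
        have a2 := mul_nonneg hqq (neg_nonneg.mpr h)
        linarith
      · have hg : gg K j X = (dd K X - j) * (13 - dd K X) := max_eq_right h.le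
        rw [hg]
        apply mul_le_mul_of_nonneg_right _ h.le
        have hd0 := dd_nonneg hK hX.2.2
        have hd : dd K X < 13 := by
          by_contra hc
          rcases hj with rfl | rfl <;> nlinarith
        have ha : pts (tanPts K N) X = pts K X := by
          apply le_antisymm (pts_le_of_subset (tanPts_subset N) X)
          apply card_le_card
          intro P hP
          have hP' := mem_inc.mp hP
          exact mem_inc.mpr ⟨hSn (mem_inc.mpr ⟨hP'.1, hP'.2.trans hX.2.1⟩), hP'.2⟩
        rw [ha]
        have hm : (pts K X : ℤ) = q + 2 - dd K X := by unfold dd; ring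
        rw [hm]
        apply mul_le_mul <;> linarith
    rw [← mul_sum] at h2
    have h3 := mul_le_mul_of_nonneg_left h1 hqq
    linarith
  have t1 := sum_le_sum hper
  rw [sum_const, nsmul_eq_mul, ← mul_sum] at t1
  have t2 : ∑ N ∈ NN K j, H N ≤ ∑ N ∈ univ.filter (fun N => N ∉ K), H N :=
    sum_le_sum_of_subset_of_nonneg (filter_subset _ _) (fun N _ _ => hH0 N)
  rw [hH, sum_planes_swap hK] at t2
  have t3 : EE K (fun X => dd K X ^ 2 * gg K j X) ≤ EE K (fun X => 90 * ((dd K X - j) * (dd K X - j))) :=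
    EE_mono (fun X hX => gg_le j _ hj (dd_nonneg hK hX))
  rw [EE_smul] at t3
  linarith

theorem core (hV : finrank F V = 5) (h2 : (2 : F) = 0) (hK : CapF K) (hq : 2048 ≤ Fintype.card F)
    (hcomp : ∀ N ∉ K, ∃ P ∈ K, P ∉ tanPts K N) {P : ℙ F V} (hP : P ∈ K)
    (ht : tt K ≤ 3 * (Fintype.card F : ℤ) ^ 2 - 130 * Fintype.card F) : False := by
  have hq' : (2048 : ℤ) ≤ Fintype.card F := by exact_mod_cast hq
  have hk : (K.card : ℤ) = (Fintype.card F : ℤ) ^ 3 + (Fintype.card F : ℤ) ^ 2 + Fintype.card F + 2 - tt K := by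
    unfold tt; ring
  have ht0 : 0 < tt K := lt_of_le_of_ne (tt_nonneg hV hK hP) (tt_ne_zero hV hK hq hP).symm
  obtain ⟨j, hj, h1, h3⟩ := num_vals _ _ _ hq' ht0 ht hk (quad_nonneg hV h2 hK hP hcomp)
  have hD : |tt K - j * ((Fintype.card F : ℤ) ^ 2 + Fintype.card F + 1)| ≤ 10 * (Fintype.card F : ℤ) :=
    abs_le.mpr ⟨by linarith, by linarith⟩
  have hVV : EE K (fun X => (dd K X - j) * (dd K X - j)) ≤
      K.card * (9 * Fintype.card F * (K.card - 1)) :=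
    (quad_ineq hV h2 hK hcomp j j).trans
      (mul_le_mul_of_nonneg_left (num_V _ _ _ j hq' hj h1 h3 hk) (by positivity))
  have hq2 : (0 : ℤ) ≤ (Fintype.card F : ℤ) ^ 2 - 2 * Fintype.card F := by nlinarith
  exact num_final _ _ _ j _ _ hq' hj h1 h3 hk hVV
    ((mul_le_mul_of_nonneg_left (good_EE hV hK hq hD) hq2).trans (NN_lower hV h2 hK hq hcomp hj))
    (NN_upper hK hq hj)

end fin
end CapAux

theorem stmt5 (F : Type*) [Field F] [Fintype F] (q : ℕ) (hcard : Fintype.card F = q)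
    (hqeven : Even q) (hq : 2048 ≤ q)
    (K : Set (PGPoint F 4)) (hK : IsCompleteCap K)
    (hk : (q : ℝ) ^ 3 - 2 * (q : ℝ) ^ 2 + 3 * (q : ℝ) * Real.sqrt q + 8 * (q : ℝ) - 9 * Real.sqrt q - 6 ≤ (K.ncard : ℝ)) :
    ∀ N : PGPoint F 4, N ∉ K →
      ∃ δ : Submodule F (Fin 5 → F), Module.finrank F δ = 4 ∧
        ∀ ℓ : Submodule F (Fin 5 → F), IsTangent K ℓ → N.submodule ≤ ℓ → ℓ ≤ δ := by
  classical
  exfalso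
  haveI : Finite (Fin 5 → F) := inferInstance
  haveI : Fintype (Projectivization F (Fin 5 → F)) := Fintype.ofFinite _
  haveI : Finite (Submodule F (Fin 5 → F)) := Finite.of_injective _ SetLike.coe_injective
  haveI : Fintype (Submodule F (Fin 5 → F)) := Fintype.ofFinite _
  have h2 : (2 : F) = 0 := by
    obtain ⟨p, hp⟩ := CharP.exists F
    haveI := hp
    obtain ⟨n, hpp, hn⟩ := FiniteField.card F p
    have hp2 : 2 ∣ p ^ (n : ℕ) := by rw [← hn, hcard]; exact hqeven.two_dvd
    have hpe : 2 = p := (Nat.prime_dvd_prime_iff_eq Nat.prime_two hpp).mp (Nat.prime_two.dvd_of_dvd_pow hp2)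
    subst hpe
    exact_mod_cast CharP.cast_eq_zero F 2
  have hV : finrank F (Fin 5 → F) = 5 := by simp
  obtain ⟨A, hA⟩ : ∃ A : Finset (Projectivization F (Fin 5 → F)), (A : Set _) = K :=
    ⟨(Set.toFinite K).toFinset, by simp⟩
  have hmem : ∀ P, P ∈ A ↔ P ∈ K := fun P => by rw [← hA]; simp
  have hcol : ∀ P Q R : PGPoint F 4, P ≠ Q → (Coll3 P Q R ↔ R.submodule ≤ P.submodule ⊔ Q.submodule) := by
    intro P Q R hPQ
    unfold Coll3
    have hl := CapAux.finrank_line hPQ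
    constructor
    · intro h
      by_contra hR
      have := CapAux.finrank_sup_pt hR
      omega
    · intro h
      rw [sup_eq_left.mpr h, hl]
  have hcap : CapAux.CapF A := by
    intro P hP Q hQ R hR hPQ hPR hQR h
    exact hK.1 P ((hmem P).mp hP) Q ((hmem Q).mp hQ) R ((hmem R).mp hR) hPQ hPR hQR ((hcol P Q R hPQ).mpr h)
  have hAc : A.card = K.ncard := by rw [← hA, Set.ncard_coe_finset]
  have hqr : (2048 : ℝ) ≤ q := by exact_mod_cast hq
  have hs : (45 : ℝ) ≤ Real.sqrt q := Real.le_sqrt_of_sq_le (by norm_num; linarith)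
  have ht : CapAux.tt A ≤ 3 * (Fintype.card F : ℤ) ^ 2 - 130 * Fintype.card F := by
    have : ((CapAux.tt A : ℤ) : ℝ) ≤ 3 * (q : ℝ) ^ 2 - 130 * q := by
      unfold CapAux.tt
      rw [hcard, hAc]
      push_cast
      nlinarith [mul_le_mul_of_nonneg_right hs (by linarith : (0 : ℝ) ≤ 3 * (q - 3))]
    rw [hcard]
    exact_mod_cast this
  have hcomp : ∀ N ∉ A, ∃ P ∈ A, P ∉ CapAux.tanPts A N := by
    intro N hN
    have hN' : N ∉ K := fun h => hN ((hmem N).mpr h)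
    have key : ∀ P ∈ K, ∀ Q ∈ K, P ≠ Q → Coll3 N P Q → ∃ P ∈ A, P ∉ CapAux.tanPts A N := by
      intro P hP Q hQ hPQ hc
      have hNP : N ≠ P := fun h => hN' (h ▸ hP)
      refine ⟨P, (hmem P).mpr hP, fun hPt => ?_⟩
      exact hPQ ((CapAux.mem_tanPts.mp hPt).2 Q ((hmem Q).mpr hQ) ((hcol N P Q hNP).mp hc)).symm
    have h := hK.2 N hN'
    unfold IsCap at h
    push Not at h
    obtain ⟨P₁, h₁, P₂, h₂, P₃, h₃, n12, n13, n23, hc⟩ := h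
    rw [Set.mem_insert_iff] at h₁ h₂ h₃
    rcases h₁ with rfl | h₁
    · exact key P₂ (h₂.resolve_left n12.symm) P₃ (h₃.resolve_left n13.symm) n23 hc
    rcases h₂ with rfl | h₂
    · refine key P₁ h₁ P₃ (h₃.resolve_left n23.symm) n13 ?_
      unfold Coll3 at hc ⊢
      rwa [sup_comm P₂.submodule P₁.submodule]
    rcases h₃ with rfl | h₃
    · refine key P₁ h₁ P₂ h₂ n12 ?_
      unfold Coll3 at hc ⊢
      rwa [sup_assoc, sup_comm]
    · exact absurd hc (hK.1 P₁ h₁ P₂ h₂ P₃ h₃ n12 n13 n23)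
  have hpos : 0 < A.card := by
    rw [hAc]
    have : (0 : ℝ) < K.ncard := by
      refine lt_of_lt_of_le ?_ hk
      nlinarith [mul_le_mul_of_nonneg_right hs (by linarith : (0 : ℝ) ≤ 3 * (q - 3)),
        mul_nonneg (sq_nonneg (q : ℝ)) (by linarith : (0 : ℝ) ≤ q - 2)]
    exact_mod_cast this
  obtain ⟨P, hP⟩ := Finset.card_pos.mp hpos
  exact CapAux.core hV h2 hcap (by rw [hcard]; exact hq) hcomp hP ht
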